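/- arXiv:0805.3869 — 3 statements merged into one kernel-verified Lean document; each statement's English description precedes it below -/
import Mathlib

section
/- There exists a constant D_s > 0, depending only on a, such that for every function u, continuously differentiable on ℝ × [0,∞) with ∫_{ℝ²₊} |∇u(x,y)|² y^a dx dy < ∞, the trace v(x) := u(x,0) satisfies ∬_{ℝ×ℝ} |v(x) − v(x')|²/|x − x'|^{1+2s} dx dx' ≤ D_s ∫_{ℝ²₊} |∇u(x,y)|² y^a dx dy. -/
open Real MeasureTheory Set
open scoped ENNReal

/-- Cauchy–Schwarz for lower integrals against the constant function `1`. -/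
theorem sq_setLIntegral_le {f : ℝ → ℝ≥0∞} (hf : Measurable f) {k : ℝ} :
    (∫⁻ t in Ioc 0 k, f t) ^ 2 ≤ ENNReal.ofReal k * ∫⁻ t in Ioc 0 k, f t ^ 2 := by
  have h := ENNReal.lintegral_mul_le_Lp_mul_Lq (volume.restrict (Ioc 0 k))
    Real.HolderConjugate.two_two (f := fun _ => 1) (g := f) aemeasurable_const hf.aemeasurable
  simp only [Pi.mul_apply, one_mul, ENNReal.one_rpow, lintegral_const, Measure.restrict_apply_univ,
    Real.volume_Ioc, sub_zero] at h
  calc (∫⁻ t in Ioc 0 k, f t) ^ 2 ≤ _ := pow_le_pow_left' h 2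
    _ = _ := by
      rw [mul_pow, ← ENNReal.rpow_natCast, ← ENNReal.rpow_natCast, ← ENNReal.rpow_mul,
        ← ENNReal.rpow_mul]
      norm_num

/-- The increment of `u` along a ray of slope `±1` issued from a boundary point. -/
theorem ofReal_sq_increment_le {u : ℝ × ℝ → ℝ} (hu : ContDiffOn ℝ 1 u (univ ×ˢ Ici (0 : ℝ)))
    (x : ℝ) {τ k : ℝ} (hτ : |τ| = 1) (hk : 0 < k) :
    ENNReal.ofReal ((u (x + τ * k, k) - u (x, 0)) ^ 2) ≤
      ENNReal.ofReal k * ∫⁻ t in Ioc 0 k, ‖fderiv ℝ u (x + τ * t, t)‖ₑ ^ 2 := by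
  have hray : ContDiff ℝ 1 fun t : ℝ => (x + τ * t, t) := by fun_prop
  have hφ : ContDiffOn ℝ 1 (fun t : ℝ => u (x + τ * t, t)) (Icc 0 k) :=
    hu.comp hray.contDiffOn fun t ht => ⟨mem_univ _, ht.1⟩
  have hmeas : Measurable fun t : ℝ => ‖fderiv ℝ u (x + τ * t, t)‖ₑ :=
    ((measurable_fderiv ℝ u).comp hray.continuous.measurable).enorm
  have hle : ‖u (x + τ * k, k) - u (x, 0)‖ₑ ≤
      ∫⁻ t in Ioc 0 k, ‖fderiv ℝ u (x + τ * t, t)‖ₑ := by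
    have h := enorm_sub_le_lintegral_deriv_of_contDiffOn_Icc hφ hk.le
    simp only [mul_zero, add_zero] at h
    refine h.trans ?_
    rw [← restrict_Ioo_eq_restrict_Icc, ← restrict_Ioo_eq_restrict_Ioc]
    refine setLIntegral_mono' measurableSet_Ioo fun t ht => ?_
    have hd : DifferentiableAt ℝ u (x + τ * t, t) :=
      (hu.differentiableOn one_ne_zero).differentiableAt
        (prod_mem_nhds Filter.univ_mem (Ici_mem_nhds ht.1))
    have hr : HasDerivAt (fun t : ℝ => (x + τ * t, t)) (τ, 1) t := by
      simpa using (((hasDerivAt_id t).const_mul τ).const_add x).prodMk (hasDerivAt_id t)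
    have hder : deriv (fun t : ℝ => u (x + τ * t, t)) t = fderiv ℝ u (x + τ * t, t) (τ, 1) :=
      (hd.hasFDerivAt.comp_hasDerivAt (f := fun t : ℝ => (x + τ * t, t)) t hr).deriv
    rw [hder, enorm_le_iff_norm_le]
    refine (ContinuousLinearMap.le_opNorm _ _).trans_eq ?_
    simp [Prod.norm_def, hτ]
  calc _ = ‖u (x + τ * k, k) - u (x, 0)‖ₑ ^ 2 := by
        rw [Real.enorm_eq_ofReal_abs, ← ENNReal.ofReal_pow (abs_nonneg _), sq_abs]
    _ ≤ _ := pow_le_pow_left' hle 2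
    _ ≤ _ := sq_setLIntegral_le hmeas

/-- A power kernel of exponent `a - 1`, truncated to distances at least `2 * t`, has mass of order
`t ^ a`. -/
theorem lintegral_rpow_tail_le {a t : ℝ} (ha : a < 0) (ht : 0 < t) (x : ℝ) :
    ∫⁻ x', (Ici (2 * t)).indicator (fun r : ℝ => ENNReal.ofReal (r ^ (a - 1))) |x - x'| ≤
      ENNReal.ofReal (2 * (2 ^ a / -a)) * ENNReal.ofReal (t ^ a) := by
  set w := (Ici (2 * t)).indicator (fun r : ℝ => ENNReal.ofReal (r ^ (a - 1))) with hw
  have hwm : Measurable w := Measurable.indicator (by fun_prop) measurableSet_Ici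
  have hint : ∫⁻ r, w r = ENNReal.ofReal (2 ^ a / -a * t ^ a) := by
    rw [hw, lintegral_indicator measurableSet_Ici, ← restrict_Ioi_eq_restrict_Ici,
      ← ofReal_integral_eq_lintegral_ofReal
        (integrableOn_Ioi_rpow_of_lt (by linarith) (by linarith)),
      integral_Ioi_rpow_of_lt (by linarith) (by linarith), sub_add_cancel,
      Real.mul_rpow zero_le_two ht.le]
    · congr 1
      field_simp
    · filter_upwards [self_mem_ae_restrict measurableSet_Ioi] with r hr
      exact Real.rpow_nonneg (by linarith [mem_Ioi.1 hr]) _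
  calc ∫⁻ x', w |x - x'| ≤ ∫⁻ x', (w (x - x') + w (x' - x)) := by
        refine lintegral_mono fun x' => ?_
        rcases abs_choice (x - x') with h | h
        · rw [h]; exact le_self_add
        · rw [h, neg_sub]; exact le_add_self
    _ = ENNReal.ofReal (2 * (2 ^ a / -a)) * ENNReal.ofReal (t ^ a) := by
        have h2 : (0 : ℝ) ≤ 2 ^ a / -a := div_nonneg (by positivity) (by linarith)
        rw [lintegral_add_left (by fun_prop), lintegral_sub_left_eq_self,
          lintegral_sub_right_eq_self, hint, ← ENNReal.ofReal_add (by positivity) (by positivity),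
          ← ENNReal.ofReal_mul (by positivity)]
        ring_nf

theorem measurable_indicator_rpow (a : ℝ) : Measurable fun q : ℝ × ℝ =>
    (Ici (2 * q.1)).indicator (fun r : ℝ => ENNReal.ofReal (r ^ (a - 1))) q.2 := by
  have : MeasurableSet {q : ℝ × ℝ | 2 * q.1 ≤ q.2} :=
    measurableSet_le (by fun_prop) (by fun_prop)
  exact Measurable.indicator (f := fun q : ℝ × ℝ => ENNReal.ofReal (q.2 ^ (a - 1)))
    (by fun_prop) this

theorem rpow_mul_lintegral_ray (a τ : ℝ) (F : ℝ × ℝ → ℝ≥0∞) (x x' : ℝ) :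
    ENNReal.ofReal (|x - x'| ^ (a - 1)) *
      ∫⁻ t in Ioc 0 (|x - x'| / 2), F (x + τ * t, t) = ∫⁻ t in Ioi 0, F (x + τ * t, t) *
        (Ici (2 * t)).indicator (fun r : ℝ => ENNReal.ofReal (r ^ (a - 1))) |x - x'| := by
  rw [← lintegral_indicator measurableSet_Ioc, ← lintegral_indicator measurableSet_Ioi,
    ← lintegral_const_mul' _ _ ENNReal.ofReal_ne_top]
  refine lintegral_congr fun t => ?_
  have h : t ≤ |x - x'| / 2 ↔ 2 * t ≤ |x - x'| := by constructor <;> intro <;> linarith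
  by_cases h0 : 0 < t <;> simp [indicator, h, h0, mul_comm]

theorem measurable_rpow_mul_lintegral_ray (a τ : ℝ) {F : ℝ × ℝ → ℝ≥0∞} (hF : Measurable F) :
    Measurable fun q : ℝ × ℝ => ENNReal.ofReal (|q.1 - q.2| ^ (a - 1)) *
      ∫⁻ t in Ioc 0 (|q.1 - q.2| / 2), F (q.1 + τ * t, t) := by
  simp_rw [rpow_mul_lintegral_ray]
  refine Measurable.lintegral_prod_right' (f := fun z : (ℝ × ℝ) × ℝ => F (z.1.1 + τ * z.2, z.2) *
    (Ici (2 * z.2)).indicator (fun r : ℝ => ENNReal.ofReal (r ^ (a - 1))) |z.1.1 - z.1.2|) ?_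
  refine (hF.comp (f := fun z : (ℝ × ℝ) × ℝ => (z.1.1 + τ * z.2, z.2)) (by fun_prop)).mul ?_
  exact (measurable_indicator_rpow a).comp
    (f := fun z : (ℝ × ℝ) × ℝ => (z.2, |z.1.1 - z.1.2|)) (by fun_prop)

/-- Integrating a nonnegative function along all rays of slope `1 / τ`, weighted by a power of the
distance of the two boundary points, is controlled by its integral against `y ^ a`. -/
theorem lintegral_rays_le {a : ℝ} (ha : a < 0) {F : ℝ × ℝ → ℝ≥0∞} (hF : Measurable F) (τ : ℝ) :
    ∫⁻ x : ℝ, ∫⁻ x' : ℝ, ENNReal.ofReal (|x - x'| ^ (a - 1)) *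
        ∫⁻ t in Ioc 0 (|x - x'| / 2), F (x + τ * t, t) ≤
      ENNReal.ofReal (2 * (2 ^ a / -a)) *
        ∫⁻ p in {p : ℝ × ℝ | 0 < p.2}, F p * ENNReal.ofReal (p.2 ^ a) := by
  set M := ENNReal.ofReal (2 * (2 ^ a / -a))
  calc _ = ∫⁻ x : ℝ, ∫⁻ t in Ioi 0, ∫⁻ x' : ℝ, F (x + τ * t, t) *
          (Ici (2 * t)).indicator (fun r : ℝ => ENNReal.ofReal (r ^ (a - 1))) |x - x'| := by
        refine lintegral_congr fun x => ?_
        simp_rw [rpow_mul_lintegral_ray]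
        refine lintegral_lintegral_swap (Measurable.aemeasurable ?_)
        refine (hF.comp (g := F) (f := fun q : ℝ × ℝ => (x + τ * q.2, q.2)) (by fun_prop)).mul ?_
        exact (measurable_indicator_rpow a).comp
          (f := fun q : ℝ × ℝ => (q.2, |x - q.1|)) (by fun_prop)
    _ ≤ ∫⁻ x : ℝ, ∫⁻ t in Ioi 0, M * (F (x + τ * t, t) * ENNReal.ofReal (t ^ a)) := by
        refine lintegral_mono fun x => setLIntegral_mono' measurableSet_Ioi fun t ht => ?_
        have hm : Measurable fun x' : ℝ =>
            (Ici (2 * t)).indicator (fun r : ℝ => ENNReal.ofReal (r ^ (a - 1))) |x - x'| :=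
          (measurable_indicator_rpow a).comp (f := fun x' : ℝ => (t, |x - x'|)) (by fun_prop)
        rw [lintegral_const_mul _ hm, mul_left_comm]
        exact mul_le_mul_right (lintegral_rpow_tail_le ha ht x) _
    _ = ∫⁻ t in Ioi 0, ∫⁻ x : ℝ, M * (F (x + τ * t, t) * ENNReal.ofReal (t ^ a)) := by
        refine lintegral_lintegral_swap (Measurable.aemeasurable ?_)
        refine Measurable.const_mul (Measurable.mul ?_ (by fun_prop)) _
        exact hF.comp (f := fun q : ℝ × ℝ => (q.1 + τ * q.2, q.2)) (by fun_prop)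
    _ = ∫⁻ t in Ioi 0, ∫⁻ x : ℝ, M * (F (x, t) * ENNReal.ofReal (t ^ a)) := by
        refine lintegral_congr fun t => ?_
        exact lintegral_add_right_eq_self
          (fun x => M * (F (x, t) * ENNReal.ofReal (t ^ a))) (τ * t)
    _ = _ := by
        have hset : {p : ℝ × ℝ | 0 < p.2} = univ ×ˢ Ioi 0 := by ext; simp
        have hm : Measurable fun p : ℝ × ℝ => F p * ENNReal.ofReal (p.2 ^ a) := by fun_prop
        rw [← lintegral_const_mul _ hm, hset, Measure.volume_eq_prod, ← Measure.prod_restrict,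
          lintegral_prod_symm _ (hm.const_mul _).aemeasurable, Measure.restrict_univ]

/-- Boundary increments are controlled by integrating the squared gradient along the two rays of
slopes `±1` that meet above the midpoint of the two boundary points. -/
theorem ofReal_sq_sub_div_le {u : ℝ × ℝ → ℝ} (hu : ContDiffOn ℝ 1 u (univ ×ˢ Ici (0 : ℝ)))
    (a x x' : ℝ) {σ : ℝ} (hσ : |σ| = 1) (hx : x' - x = σ * |x - x'|) :
    ENNReal.ofReal ((u (x, 0) - u (x', 0)) ^ 2 / |x - x'| ^ (2 - a)) ≤
      ENNReal.ofReal (|x - x'| ^ (a - 1)) *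
        ((∫⁻ t in Ioc 0 (|x - x'| / 2), ‖fderiv ℝ u (x + σ * t, t)‖ₑ ^ 2) +
          ∫⁻ t in Ioc 0 (|x - x'| / 2), ‖fderiv ℝ u (x' + -σ * t, t)‖ₑ ^ 2) := by
  rcases eq_or_ne x x' with rfl | hne
  · simp
  set h := |x - x'|
  have hpos : 0 < h := abs_pos.2 (sub_ne_zero.2 hne)
  have h1 := ofReal_sq_increment_le hu x hσ (half_pos hpos)
  have h2 := ofReal_sq_increment_le hu x' (τ := -σ) (by rwa [abs_neg]) (half_pos hpos)
  have hmid : x' + -σ * (h / 2) = x + σ * (h / 2) := by linarith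
  rw [hmid] at h2
  set m := u (x + σ * (h / 2), h / 2)
  have hpow : h ^ (a - 1) = h / h ^ (2 - a) := by
    rw [show a - 1 = 1 - (2 - a) by ring, Real.rpow_sub hpos, Real.rpow_one]
  have hreal : (u (x, 0) - u (x', 0)) ^ 2 / h ^ (2 - a) ≤
      2 / h ^ (2 - a) * ((m - u (x, 0)) ^ 2 + (m - u (x', 0)) ^ 2) := by
    rw [div_mul_eq_mul_div]
    gcongr
    nlinarith [sq_nonneg ((m - u (x, 0)) + (m - u (x', 0)))]
  calc _ ≤ _ := ENNReal.ofReal_le_ofReal hreal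
    _ = ENNReal.ofReal (2 / h ^ (2 - a)) * (ENNReal.ofReal ((m - u (x, 0)) ^ 2) +
          ENNReal.ofReal ((m - u (x', 0)) ^ 2)) := by
        rw [ENNReal.ofReal_mul (by positivity), ENNReal.ofReal_add (by positivity) (by positivity)]
    _ ≤ _ := by
        grw [h1, h2, ← mul_add, ← mul_assoc, ← ENNReal.ofReal_mul (by positivity), hpow]
        apply le_of_eq
        congr 2
        ring

/- STATEMENT 4: There is D_s > 0, depending only on a, such that every u which is C¹ on
the closed half-plane with finite weighted energy satisfies the trace inequality
∬ |u(x,0) − u(x',0)|²/|x − x'|^{1+2s} dx dx' ≤ D_s ∫_{ℝ²₊} |∇u|² y^a dx dy. -/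
theorem stmt_4 (a s : ℝ) (ha : a ∈ Set.Ioo (-1 : ℝ) 0) (hs : s = (1 - a) / 2) :
    ∃ D : ℝ, 0 < D ∧
      ∀ u : ℝ × ℝ → ℝ, ContDiffOn ℝ 1 u (univ ×ˢ Ici (0 : ℝ)) →
        (∫⁻ p in {p : ℝ × ℝ | 0 < p.2},
            ENNReal.ofReal (‖fderiv ℝ u p‖ ^ 2 * p.2 ^ a)) ≠ ⊤ →
        (∫⁻ x : ℝ, ∫⁻ x' : ℝ,
            ENNReal.ofReal ((u (x, 0) - u (x', 0)) ^ 2 / |x - x'| ^ (1 + 2 * s))) ≤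
          ENNReal.ofReal D *
            ∫⁻ p in {p : ℝ × ℝ | 0 < p.2},
              ENNReal.ofReal (‖fderiv ℝ u p‖ ^ 2 * p.2 ^ a) := by
  have ha0 : 0 < -a := neg_pos.2 ha.2
  refine ⟨4 * (2 * (2 ^ a / -a)), by positivity, fun u hu _ => ?_⟩
  have hexp : 1 + 2 * s = 2 - a := by rw [hs]; ring
  set F : ℝ × ℝ → ℝ≥0∞ := fun p => ‖fderiv ℝ u p‖ₑ ^ 2
  have hF : Measurable F := (measurable_fderiv ℝ u).enorm.pow_const 2
  have hE : ∫⁻ p in {p : ℝ × ℝ | 0 < p.2}, ENNReal.ofReal (‖fderiv ℝ u p‖ ^ 2 * p.2 ^ a) =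
      ∫⁻ p in {p : ℝ × ℝ | 0 < p.2}, F p * ENNReal.ofReal (p.2 ^ a) := by
    refine lintegral_congr fun p => ?_
    rw [ENNReal.ofReal_mul (by positivity), ENNReal.ofReal_pow (norm_nonneg _), ofReal_norm]
  set B : ℝ → ℝ → ℝ → ℝ≥0∞ := fun τ x x' => ENNReal.ofReal (|x - x'| ^ (a - 1)) *
    ∫⁻ t in Ioc 0 (|x - x'| / 2), F (x + τ * t, t) with hB
  have hBm (τ : ℝ) : Measurable fun q : ℝ × ℝ => B τ q.1 q.2 :=
    measurable_rpow_mul_lintegral_ray a τ hF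
  have hpt (x x' : ℝ) : ENNReal.ofReal ((u (x, 0) - u (x', 0)) ^ 2 / |x - x'| ^ (1 + 2 * s)) ≤
      B 1 x x' + B (-1) x x' + (B 1 x' x + B (-1) x' x) := by
    rw [hexp]
    rcases le_total x x' with h | h
    · refine (ofReal_sq_sub_div_le hu a x x' (σ := 1) (by simp)
        (by rw [abs_of_nonpos (by linarith)]; ring)).trans ?_
      rw [mul_add]
      refine add_le_add le_self_add (le_trans (le_of_eq ?_) le_add_self)
      simp only [hB, abs_sub_comm x x']
      rfl
    · refine (ofReal_sq_sub_div_le hu a x x' (σ := -1) (by simp)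
        (by rw [abs_of_nonneg (by linarith)]; ring)).trans ?_
      rw [mul_add]
      refine add_le_add le_add_self (le_trans (le_of_eq ?_) le_self_add)
      simp only [hB, abs_sub_comm x x', neg_neg]
      rfl
  have hray (τ : ℝ) := lintegral_rays_le ha.2 hF τ
  have hSm : Measurable fun q : ℝ × ℝ => B 1 q.1 q.2 + B (-1) q.1 q.2 := (hBm 1).add (hBm (-1))
  have hS : ∫⁻ x, ∫⁻ x', (B 1 x x' + B (-1) x x') =
      (∫⁻ x, ∫⁻ x', B 1 x x') + ∫⁻ x, ∫⁻ x', B (-1) x x' := by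
    rw [← lintegral_add_left (hBm 1).lintegral_prod_right']
    exact lintegral_congr fun x => lintegral_add_left ((hBm 1).comp measurable_prodMk_left) _
  calc _ ≤ ∫⁻ x, ∫⁻ x', (B 1 x x' + B (-1) x x' + (B 1 x' x + B (-1) x' x)) :=
        lintegral_mono fun x => lintegral_mono fun x' => hpt x x'
    _ = ∫⁻ x, ((∫⁻ x', (B 1 x x' + B (-1) x x')) + ∫⁻ x', (B 1 x' x + B (-1) x' x)) :=
        lintegral_congr fun x => lintegral_add_left (hSm.comp measurable_prodMk_left) _
    _ = (∫⁻ x, ∫⁻ x', (B 1 x x' + B (-1) x x')) + ∫⁻ x, ∫⁻ x', (B 1 x' x + B (-1) x' x) :=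
        lintegral_add_left hSm.lintegral_prod_right' _
    _ = (∫⁻ x, ∫⁻ x', B 1 x x') + (∫⁻ x, ∫⁻ x', B (-1) x x') +
          ((∫⁻ x, ∫⁻ x', B 1 x x') + ∫⁻ x, ∫⁻ x', B (-1) x x') := by
        rw [← lintegral_lintegral_swap (f := fun x x' => B 1 x x' + B (-1) x x') hSm.aemeasurable,
          hS]
    _ ≤ _ := by
        rw [hE, ENNReal.ofReal_mul (by norm_num), mul_assoc]
        refine (add_le_add (add_le_add (hray 1) (hray (-1)))
          (add_le_add (hray 1) (hray (-1)))).trans_eq ?_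
        norm_num
        ring
end

section
/- Let E ⊂ ℝ be a bounded open interval, and assume additionally that V(t) ≥ c|t| for all |t| ≥ R, for some constants c, R > 0. Let ε_n → 0⁺ and let (v_n) be a sequence of measurable functions on E with sup_n G_{ε_n}[v_n, E] < ∞. Then (v_n) has a subsequence converging in L¹(E) to a function v such that v(x) ∈ {α', β'} for almost every x ∈ E and v has finitely many jumps; that is, there exist finitely many points partitioning E into finitely many open subintervals on each of which v is almost everywhere constant, equal to α' or to β'. -/
open Real MeasureTheory Set Filter
open scoped ENNReal

/-- The Gagliardo-type double integral ∬_{E×E} |v(x') − v(x)|²/|x' − x|^{1+2s} dx' dx. -/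
noncomputable def gag (s : ℝ) (E : Set ℝ) (v : ℝ → ℝ) : ℝ≥0∞ :=
  ∫⁻ x in E, ∫⁻ x' in E, ENNReal.ofReal ((v x' - v x) ^ 2 / |x' - x| ^ (1 + 2 * s))

/-- The functional
G_ε[v, E] := (ε^{1−a}/D) ∬_{E×E} |v(x')−v(x)|²/|x'−x|^{1+2s} + ε^{−(1−a)/(−a)} ∫_E V(v). -/
noncomputable def Gfun (a s D : ℝ) (V : ℝ → ℝ) (ε : ℝ) (E : Set ℝ) (v : ℝ → ℝ) : ℝ≥0∞ :=
  ENNReal.ofReal (ε ^ (1 - a) / D) * gag s E v +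
    ENNReal.ofReal (ε ^ (-((1 - a) / (-a)))) * ∫⁻ x in E, ENNReal.ofReal (V (v x))

/-- A sign function flipping at each of the points `e 0, …, e (N - 1)`. -/
noncomputable def flipSign (N : ℕ) (e : ℕ → ℝ) (x : ℝ) : ℝ :=
  ∏ i ∈ Finset.range N, if e i ≤ x then (-1 : ℝ) else 1

lemma flipSign_eq_or (N : ℕ) (e : ℕ → ℝ) (x : ℝ) : flipSign N e x = 1 ∨ flipSign N e x = -1 := by
  unfold flipSign
  induction N with
  | zero => simp
  | succ N ih =>
    rw [Finset.prod_range_succ]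
    split_ifs <;> rcases ih with h | h <;> simp [h]

lemma measurable_flipSign (N : ℕ) (e : ℕ → ℝ) : Measurable (flipSign N e) := by
  unfold flipSign
  refine Finset.measurable_fun_prod _ fun i _ => ?_
  exact Measurable.ite measurableSet_Ici measurable_const measurable_const

lemma tendsto_flipSign {N : ℕ} {e : ℕ → ℕ → ℝ} {e' : ℕ → ℝ} (he : Tendsto e atTop (nhds e'))
    {x : ℝ} (hx : ∀ i < N, e' i ≠ x) :
    Tendsto (fun n => flipSign N (e n) x) atTop (nhds (flipSign N e' x)) := by
  unfold flipSign
  refine tendsto_finsetProd _ fun i hi => ?_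
  have hei : Tendsto (fun n => e n i) atTop (nhds (e' i)) := (tendsto_pi_nhds.1 he) i
  rcases lt_or_gt_of_ne (hx i (Finset.mem_range.1 hi)) with h | h
  · refine tendsto_const_nhds.congr' ?_
    filter_upwards [hei.eventually (gt_mem_nhds h)] with n hn
    rw [if_pos h.le, if_pos hn.le]
  · refine tendsto_const_nhds.congr' ?_
    filter_upwards [hei.eventually (lt_mem_nhds h)] with n hn
    rw [if_neg h.not_ge, if_neg hn.not_ge]

/-- A finite set of at most `N` indices can be enumerated by `range N`, padding with `b`. -/
lemma exists_enumeration (t : ℕ → ℝ) (b : ℝ) (J : Finset ℕ) :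
    ∀ N, J.card ≤ N → ∃ e : ℕ → ℝ, (∀ i, e i = b ∨ ∃ j ∈ J, e i = t j) ∧
      ∀ F : ℝ → ℝ, F b = 1 → ∏ i ∈ Finset.range N, F (e i) = ∏ j ∈ J, F (t j) := by
  induction J using Finset.induction_on with
  | empty =>
    intro N _
    exact ⟨fun _ => b, fun _ => Or.inl rfl, fun F hF => by simp [hF]⟩
  | insert j J hj ih =>
    intro N hN
    rw [Finset.card_insert_of_notMem hj] at hN
    obtain ⟨N', rfl⟩ : ∃ N', N = N' + 1 := ⟨N - 1, by omega⟩
    obtain ⟨e, he, hF⟩ := ih N' (by omega)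
    refine ⟨Function.update e N' (t j), fun i => ?_, fun F hFb => ?_⟩
    · by_cases hi : i = N'
      · subst hi
        exact Or.inr ⟨j, by simp⟩
      · rw [Function.update_of_ne hi]
        rcases he i with h | ⟨k, hk, h⟩
        · exact Or.inl h
        · exact Or.inr ⟨k, Finset.mem_insert_of_mem hk, h⟩
    · rw [Finset.prod_range_succ, Finset.prod_insert hj, ← hF F hFb, Function.update_self, mul_comm]
      congr 1
      refine Finset.prod_congr rfl fun i hi => ?_
      rw [Function.update_of_ne (Finset.mem_range.1 hi).ne]

/-- Any finite set of reals induces a partition of `(a, b)` into finitely many intervals avoiding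
it. -/
lemma exists_partition {a b : ℝ} (hab : a < b) (F : Finset ℝ) :
    ∃ (N : ℕ) (t : ℕ → ℝ), t 0 = a ∧ t (N + 1) = b ∧ (∀ i ≤ N, t i < t (i + 1)) ∧
      ∀ i ≤ N, ∀ x ∈ F, x ∉ Ioo (t i) (t (i + 1)) := by
  classical
  set G : Finset ℝ := insert a (insert b (F.filter (· ∈ Ioo a b))) with hG
  have haG : a ∈ G := by simp [hG]
  have hbG : b ∈ G := by simp [hG]
  have hGab : ∀ x ∈ G, a ≤ x ∧ x ≤ b := by
    intro x hx
    simp only [hG, Finset.mem_insert, Finset.mem_filter, mem_Ioo] at hx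
    rcases hx with rfl | rfl | ⟨_, h1, h2⟩
    · exact ⟨le_rfl, hab.le⟩
    · exact ⟨hab.le, le_rfl⟩
    · exact ⟨h1.le, h2.le⟩
  have hcard : 2 ≤ G.card := by
    have : ({a, b} : Finset ℝ) ⊆ G := by
      intro x hx
      simp only [Finset.mem_insert, Finset.mem_singleton] at hx
      rcases hx with rfl | rfl <;> assumption
    simpa [Finset.card_pair hab.ne] using Finset.card_le_card this
  obtain ⟨N, hN⟩ : ∃ N, G.card = N + 2 := ⟨G.card - 2, by omega⟩
  set f := G.orderEmbOfFin hN
  set t : ℕ → ℝ := fun i => if h : i < N + 2 then f ⟨i, h⟩ else 0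
  have ht : ∀ i (h : i < N + 2), t i = f ⟨i, h⟩ := fun i h => dif_pos h
  have hf : ∀ i, f i ∈ G := fun i => Finset.orderEmbOfFin_mem G hN i
  have hsurj : ∀ x ∈ G, ∃ i, f i = x := by
    intro x hx
    have := Finset.range_orderEmbOfFin G hN
    rw [← Finset.mem_coe, ← this] at hx
    exact hx
  refine ⟨N, t, ?_, ?_, ?_, ?_⟩
  · rw [ht 0 (by omega)]
    obtain ⟨i, hi⟩ := hsurj a haG
    refine le_antisymm ?_ (hGab _ (hf _)).1
    exact (f.monotone (Fin.mk_le_of_le_val (Nat.zero_le _))).trans hi.le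
  · rw [ht (N + 1) (by omega)]
    obtain ⟨i, hi⟩ := hsurj b hbG
    refine le_antisymm (hGab _ (hf _)).2 ?_
    exact hi.ge.trans (f.monotone (Fin.le_def.2 (by have := i.2; simp; omega)))
  · intro i hi
    rw [ht i (by omega), ht (i + 1) (by omega)]
    exact f.strictMono (Fin.lt_def.2 (by simp))
  · intro i hi
    rw [ht i (by omega), ht (i + 1) (by omega)]
    have hsub : Ioo (f ⟨i, by omega⟩) (f ⟨i + 1, by omega⟩) ⊆ Ioo a b :=
      Ioo_subset_Ioo (hGab _ (hf _)).1 (hGab _ (hf _)).2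
    intro x hx hxI
    have hxG : x ∈ G := by
      simp only [hG, Finset.mem_insert, Finset.mem_filter]
      exact Or.inr (Or.inr ⟨hx, hsub hxI⟩)
    obtain ⟨j, rfl⟩ := hsurj x hxG
    have h1 := f.lt_iff_lt.1 hxI.1
    have h2 := f.lt_iff_lt.1 hxI.2
    rw [Fin.lt_def] at h1 h2
    simp only at h1 h2
    omega

lemma flipSign_eq_of_mem_Ioo {N : ℕ} {e : ℕ → ℝ} {p q x y : ℝ}
    (h : ∀ i < N, e i ∉ Ioo p q) (hx : x ∈ Ioo p q) (hy : y ∈ Ioo p q) :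
    flipSign N e x = flipSign N e y := by
  unfold flipSign
  refine Finset.prod_congr rfl fun i hi => ?_
  have := h i (Finset.mem_range.1 hi)
  have hiff : e i ≤ x ↔ e i ≤ y := by
    rcases le_or_gt (e i) p with h1 | h1
    · exact iff_of_true (h1.trans hx.1.le) (h1.trans hy.1.le)
    · have h2 : q ≤ e i := by
        by_contra! h2
        exact this ⟨h1, h2⟩
      exact iff_of_false (hx.2.trans_le h2).not_ge (hy.2.trans_le h2).not_ge
  simp only [hiff]

/-- The measure of the set of nearby pairs `(x, y)` at which `v` lies on different sides of `m` is
controlled by the energy. -/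
lemma transition_pairs_le {v V : ℝ → ℝ} (hv : Measurable v) (hV : Measurable V)
    {κ η δ m s : ℝ} (hκ : 0 < κ) (hη : 0 < η) (hδ : 0 < δ) (hs : 0 ≤ 1 + 2 * s)
    (h : ∀ z z', z' < m → m ≤ z → κ ≤ z - z' ∨ η ≤ V z) (E : Set ℝ) :
    ((volume.restrict E).prod (volume.restrict E))
        {q | m ≤ v q.1 ∧ v q.2 < m ∧ |q.1 - q.2| ≤ δ} ≤
      ENNReal.ofReal (δ ^ (1 + 2 * s) / κ ^ 2) * gag s E v +
        ENNReal.ofReal (2 * δ / η) * ∫⁻ x in E, ENNReal.ofReal (V (v x)) := by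
  have hS : MeasurableSet {q : ℝ × ℝ | m ≤ v q.1 ∧ v q.2 < m ∧ |q.1 - q.2| ≤ δ} := by
    have hd : Measurable fun q : ℝ × ℝ => |q.1 - q.2| := Continuous.measurable (by fun_prop)
    exact (measurableSet_le measurable_const (hv.comp measurable_fst)).inter
      ((measurableSet_lt (hv.comp measurable_snd) measurable_const).inter
        (measurableSet_le hd measurable_const))
  rw [Measure.prod_apply hS]
  have hVv : Measurable fun x => ENNReal.ofReal (V (v x)) := (hV.comp hv).ennreal_ofReal
  rw [gag, ← lintegral_const_mul' _ _ ENNReal.ofReal_ne_top,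
    ← lintegral_const_mul' _ _ ENNReal.ofReal_ne_top, ← lintegral_add_right _ (hVv.const_mul _)]
  refine lintegral_mono fun x => ?_
  set T : Set ℝ := Prod.mk x ⁻¹' {q : ℝ × ℝ | m ≤ v q.1 ∧ v q.2 < m ∧ |q.1 - q.2| ≤ δ}
  have hT : MeasurableSet T := measurable_prodMk_left hS
  by_cases hVx : η ≤ V (v x)
  · refine le_trans ?_ le_add_self
    rw [← ENNReal.ofReal_mul (by positivity)]
    calc volume.restrict E T ≤ volume T := Measure.restrict_apply_le _ _
      _ ≤ volume (Metric.closedBall x δ) := by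
        refine measure_mono fun y hy => ?_
        rw [Metric.mem_closedBall, dist_comm, Real.dist_eq]
        exact hy.2.2
      _ = ENNReal.ofReal (2 * δ) := Real.volume_closedBall _ _
      _ ≤ _ := by
        refine ENNReal.ofReal_le_ofReal ?_
        rw [div_mul_eq_mul_div, le_div_iff₀ hη]
        gcongr
  · refine le_trans ?_ le_self_add
    rw [← lintegral_const_mul' _ _ ENNReal.ofReal_ne_top]
    calc volume.restrict E T = ∫⁻ _ in T, 1 ∂(volume.restrict E) := by simp
      _ ≤ ∫⁻ y in T, ENNReal.ofReal (δ ^ (1 + 2 * s) / κ ^ 2) *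
            ENNReal.ofReal ((v y - v x) ^ 2 / |y - x| ^ (1 + 2 * s)) ∂(volume.restrict E) := by
        refine setLIntegral_mono' hT fun y hy => ?_
        obtain ⟨h1, h2, h3⟩ : m ≤ v x ∧ v y < m ∧ |x - y| ≤ δ := hy
        have hκ' : κ ≤ v x - v y := (h _ _ h2 h1).resolve_right hVx
        have hne : 0 < |y - x| := by
          rw [abs_pos, sub_ne_zero]
          rintro rfl
          linarith
        rw [← ENNReal.ofReal_mul (by positivity), ← ENNReal.ofReal_one]
        refine ENNReal.ofReal_le_ofReal ?_
        have hpow : |y - x| ^ (1 + 2 * s) ≤ δ ^ (1 + 2 * s) :=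
          Real.rpow_le_rpow hne.le (by rwa [abs_sub_comm]) hs
        have hpos : 0 < |y - x| ^ (1 + 2 * s) := Real.rpow_pos_of_pos hne _
        rw [div_mul_div_comm, le_div_iff₀ (by positivity), one_mul, mul_comm]
        have : κ ^ 2 ≤ (v y - v x) ^ 2 := by nlinarith
        gcongr
      _ ≤ _ := setLIntegral_le_lintegral _ _

/-- The distance to the wells is controlled by the potential, up to an arbitrarily small error. -/
lemma dist_wells_le {V : ℝ → ℝ} {α' β' c R : ℝ} (hV0 : ∀ t, 0 ≤ V t) (hVc : Continuous V)
    (hVz : ∀ t, V t = 0 ↔ t = α' ∨ t = β') (hc : 0 < c) (hR : 0 < R)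
    (hcoerc : ∀ t : ℝ, R ≤ |t| → c * |t| ≤ V t) {κ : ℝ} (hκ : 0 < κ) :
    ∃ L : ℝ, 0 ≤ L ∧ ∀ t, min |t - α'| |t - β'| ≤ κ + L * V t := by
  set Q : Set ℝ := Icc (-R) R ∩ {t | κ ≤ min |t - α'| |t - β'|} with hQ
  have hQc : IsCompact Q := by
    refine isCompact_Icc.inter_right (isClosed_le continuous_const ?_)
    fun_prop
  obtain ⟨η, hη, hηQ⟩ : ∃ η > 0, ∀ t ∈ Q, η ≤ V t := by
    rcases Q.eq_empty_or_nonempty with h | h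
    · exact ⟨1, one_pos, by simp [h]⟩
    · obtain ⟨t, ht, hmin⟩ := hQc.exists_isMinOn h hVc.continuousOn
      refine ⟨V t, (hV0 t).lt_of_ne' fun h0 => ?_, fun t' ht' => hmin ht'⟩
      have h2 : κ ≤ min |t - α'| |t - β'| := ht.2
      rcases (hVz t).1 h0 with rfl | rfl
      · have := h2.trans (min_le_left _ _)
        simp at this
        linarith
      · have := h2.trans (min_le_right _ _)
        simp at this
        linarith
  refine ⟨(R + |α'|) / η + (1 + |α'| / R) / c, by positivity, fun t => ?_⟩
  have hdist : min |t - α'| |t - β'| ≤ |t| + |α'| := (min_le_left _ _).trans (abs_sub _ _)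
  have hVt := hV0 t
  rw [add_mul]
  have h1 : 0 ≤ (R + |α'|) / η * V t := by positivity
  have h2 : 0 ≤ (1 + |α'| / R) / c * V t := by positivity
  rcases le_or_gt R |t| with hRt | hRt
  · have h3 : (1 + |α'| / R) / c * (c * |t|) ≤ (1 + |α'| / R) / c * V t := by
      gcongr
      exact hcoerc t hRt
    have h4 : (1 + |α'| / R) / c * (c * |t|) = |t| + |α'| / R * |t| := by field_simp
    have h5 : |α'| / R * R ≤ |α'| / R * |t| := by gcongr
    have h6 : |α'| / R * R = |α'| := by field_simp
    linarith
  · by_cases hk : κ ≤ min |t - α'| |t - β'|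
    · have htQ : t ∈ Q := ⟨abs_le.1 hRt.le, hk⟩
      have h3 : (R + |α'|) / η * η ≤ (R + |α'|) / η * V t := by
        gcongr
        exact hηQ t htQ
      have h4 : (R + |α'|) / η * η = R + |α'| := by field_simp
      linarith
    · linarith [not_le.1 hk]

/-- A sign function with few transitions at scale `δ` is close to one with a bounded number of
flips. -/
lemma exists_flipSign_near {a b K : ℝ} (hab : a < b) (hK : 0 ≤ K) :
    ∃ (N : ℕ) (L : ℝ), 0 ≤ L ∧ ∀ (χ : ℝ → ℝ) (δ : ℝ), Measurable χ →
      (∀ x, χ x = 1 ∨ χ x = -1) → 0 < δ →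
      ((volume.restrict (Ioo a b)).prod (volume.restrict (Ioo a b))).real
        {q | χ q.1 = 1 ∧ χ q.2 = -1 ∧ |q.1 - q.2| ≤ δ} ≤ K * δ ^ 2 →
      ∃ (σ : ℝ) (e : ℕ → ℝ), (σ = 1 ∨ σ = -1) ∧ (∀ i, e i ∈ Icc a b) ∧
        (volume.restrict (Ioo a b)).real {x | χ x ≠ σ * flipSign N e x} ≤ L * δ := by
  classical
  rw [Measure.restrict_congr_set (Ioo_ae_eq_Ico (μ := volume) (a := a) (b := b))]
  set μ : Measure ℝ := volume.restrict (Ico a b) with hμ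
  refine ⟨⌈72 * K⌉₊, 6 * K + 1, by positivity, fun χ δ hχ hχ1 hδ hS => ?_⟩
  rcases lt_or_ge (b - a) δ with hδab | hδab
  · refine ⟨1, fun _ => b, Or.inl rfl, fun _ => ⟨hab.le, le_rfl⟩, ?_⟩
    have h1 : μ.real {x | χ x ≠ 1 * flipSign ⌈72 * K⌉₊ (fun _ => b) x} ≤ μ.real univ :=
      measureReal_mono (subset_univ _)
    have h2 : μ.real univ = b - a := by
      simp [hμ, Real.volume_real_Ico_of_le hab.le]
    have h3 : 0 ≤ 6 * K * δ := by positivity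
    linarith
  have hℓ : 0 < b - a := sub_pos.2 hab
  set M : ℕ := ⌈2 * (b - a) / δ⌉₊
  have hM1 : 2 * (b - a) / δ ≤ M := Nat.le_ceil _
  have hM0 : (0 : ℝ) < M := lt_of_lt_of_le (by positivity) hM1
  have hM2 : (M : ℝ) ≤ 3 * (b - a) / δ := by
    have h1 : (M : ℝ) < 2 * (b - a) / δ + 1 := Nat.ceil_lt_add_one (by positivity)
    have h2 : 1 ≤ (b - a) / δ := (one_le_div hδ).2 hδab
    have h3 : 3 * (b - a) / δ = 2 * (b - a) / δ + (b - a) / δ := by ring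
    linarith
  set h : ℝ := (b - a) / M
  have hh0 : 0 < h := by positivity
  have hMh : M * h = b - a := by simp only [h]; field_simp
  have hh1 : 2 * h ≤ δ := by
    rw [div_le_iff₀ hδ, ← hMh] at hM1
    have : (M : ℝ) * (2 * h) ≤ M * δ := by linarith
    exact le_of_mul_le_mul_left this hM0
  have hh2 : δ ≤ 3 * h := by
    rw [le_div_iff₀ hδ, ← hMh] at hM2
    have : (M : ℝ) * δ ≤ M * (3 * h) := by linarith
    exact le_of_mul_le_mul_left this hM0
  set I : ℕ → Set ℝ := fun k => Ico (a + k * h) (a + (k + 1) * h)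
  have hIsub : ∀ k < M, I k ⊆ Ico a b := by
    intro k hk
    have hk' : (k : ℝ) + 1 ≤ M := by exact_mod_cast hk
    have h1 : 0 ≤ (k : ℝ) * h := by positivity
    have h2 : ((k : ℝ) + 1) * h ≤ M * h := by gcongr
    exact Ico_subset_Ico (by linarith) (by linarith)
  have hIlt : ∀ {j k x}, x ∈ I j → x ∈ I k → j ≤ k := by
    intro j k x hj hk
    have h1 : (j : ℝ) * h < (k + 1) * h := by linarith [hj.1, hk.2]
    have h2 : (j : ℝ) < k + 1 := lt_of_mul_lt_mul_right h1 hh0.le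
    exact Nat.lt_succ_iff.1 (by exact_mod_cast h2)
  have hIcover : ∀ x ∈ Ico a b, ∃ k < M, x ∈ I k := by
    intro x hx
    have hxa : 0 ≤ (x - a) / h := div_nonneg (sub_nonneg.2 hx.1) hh0.le
    have h1 := Nat.floor_le hxa
    have h2 := Nat.lt_floor_add_one ((x - a) / h)
    rw [le_div_iff₀ hh0] at h1
    rw [div_lt_iff₀ hh0] at h2
    refine ⟨⌊(x - a) / h⌋₊, ?_, ⟨by linarith, by linarith⟩⟩
    rw [Nat.floor_lt hxa, div_lt_iff₀ hh0, hMh]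
    linarith [hx.2]
  set P : ℕ → Set ℝ := fun k => I k ∩ {x | χ x = 1}
  set Q : ℕ → Set ℝ := fun k => I k ∩ {x | χ x = -1}
  have hPm : ∀ k, MeasurableSet (P k) := fun k =>
    measurableSet_Ico.inter (hχ (measurableSet_singleton 1))
  have hQm : ∀ k, MeasurableSet (Q k) := fun k =>
    measurableSet_Ico.inter (hχ (measurableSet_singleton (-1)))
  have hPQ : ∀ k < M, μ.real (P k) + μ.real (Q k) = h := by
    intro k hk
    have hdisj : Disjoint (P k) (Q k) := by
      refine Set.disjoint_left.2 fun x hx hx' => ?_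
      have h1 : χ x = 1 := hx.2
      have h2 : χ x = -1 := hx'.2
      linarith
    rw [← measureReal_union hdisj (hQm k), ← inter_union_distrib_left]
    have huniv : {x | χ x = 1} ∪ {x | χ x = -1} = univ := eq_univ_of_forall hχ1
    rw [huniv, inter_univ, hμ, measureReal_restrict_apply measurableSet_Ico,
      inter_eq_left.2 (hIsub k hk), Real.volume_real_Ico_of_le (by linarith)]
    ring
  have hPQsum : ∀ (T : Finset ℕ) (g : ℕ → ℕ),
      (∀ k ∈ T, ∀ x ∈ I k, ∀ y ∈ I (g k), |x - y| ≤ δ) →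
      ∑ k ∈ T, μ.real (P k) * μ.real (Q (g k)) ≤ K * δ ^ 2 := by
    intro T g hT
    refine le_trans ?_ hS
    simp_rw [← measureReal_prod_prod]
    rw [← measureReal_biUnion_finset]
    · refine measureReal_mono ?_
      intro q hq
      simp only [mem_iUnion] at hq
      obtain ⟨k, hk, hq⟩ := hq
      exact ⟨hq.1.2, hq.2.2, hT k hk _ hq.1.1 _ hq.2.1⟩
    · intro j _ k _ hjk
      refine Set.disjoint_left.2 fun q hq hq' => hjk ?_
      exact le_antisymm (hIlt hq.1.1 hq'.1.1) (hIlt hq'.1.1 hq.1.1)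
    · exact fun k _ => (hPm k).prod (hQm _)
  set ℓ : ℕ → ℝ := fun k => if h / 2 ≤ μ.real (P k) then 1 else -1
  have hℓ1 : ∀ k, ℓ k = 1 ∨ ℓ k = -1 := by
    intro k
    simp only [ℓ]
    split_ifs <;> simp
  have hℓP : ∀ k, ℓ k = 1 → h / 2 ≤ μ.real (P k) := by
    intro k hk
    by_contra hcon
    simp only [ℓ, if_neg hcon] at hk
    linarith
  have hℓQ : ∀ k < M, ℓ k = -1 → h / 2 ≤ μ.real (Q k) := by
    intro k hkM hk
    by_contra hcon
    have : h / 2 ≤ μ.real (P k) := by linarith [hPQ k hkM]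
    simp only [ℓ, if_pos this] at hk
    linarith
  set J : Finset ℕ := (Finset.range (M - 1)).filter fun k => ℓ k ≠ ℓ (k + 1)
  have hJM : ∀ k ∈ J, k + 1 < M := fun k hk => by
    have := Finset.mem_range.1 (Finset.mem_filter.1 hk).1
    omega
  have hJne : ∀ k ∈ J, ℓ k ≠ ℓ (k + 1) := fun k hk => (Finset.mem_filter.1 hk).2
  have hJcard : J.card ≤ ⌈72 * K⌉₊ := by
    have h1 := hPQsum J (fun k => k + 1) fun k _ x hx y hy => by
      obtain ⟨hx1, hx2⟩ := hx
      obtain ⟨hy1, hy2⟩ := hy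
      push_cast at hy1 hy2
      rw [abs_le]
      constructor <;> linarith
    have h2 := hPQsum (J.image (· + 1)) (fun k => k - 1) fun k hk x hx y hy => by
      obtain ⟨j, _, rfl⟩ := Finset.mem_image.1 hk
      obtain ⟨hx1, hx2⟩ := hx
      obtain ⟨hy1, hy2⟩ := hy
      push_cast at hx1 hx2 hy1 hy2
      rw [abs_le]
      constructor <;> linarith
    rw [Finset.sum_image (add_left_injective 1).injOn] at h2
    simp only [Nat.add_sub_cancel] at h2
    have h3 : J.card • (h / 2 * (h / 2)) ≤ ∑ k ∈ J,
        (μ.real (P k) * μ.real (Q (k + 1)) + μ.real (P (k + 1)) * μ.real (Q k)) := by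
      refine Finset.card_nsmul_le_sum _ _ _ fun k hk => ?_
      have hkM := hJM k hk
      have p1 : 0 ≤ μ.real (P k) * μ.real (Q (k + 1)) := by positivity
      have p2 : 0 ≤ μ.real (P (k + 1)) * μ.real (Q k) := by positivity
      rcases hℓ1 k with hk1 | hk1 <;> rcases hℓ1 (k + 1) with hk2 | hk2
      · exact absurd (hk1.trans hk2.symm) (hJne k hk)
      · have := mul_le_mul (hℓP _ hk1) (hℓQ _ hkM hk2) (by positivity) (by positivity)
        linarith
      · have := mul_le_mul (hℓP _ hk2) (hℓQ _ (by omega) hk1) (by positivity) (by positivity)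
        linarith
      · exact absurd (hk1.trans hk2.symm) (hJne k hk)
    rw [Finset.sum_add_distrib, nsmul_eq_mul] at h3
    have h4 : K * δ ^ 2 ≤ K * (3 * h) ^ 2 := by gcongr
    have h5 : (J.card : ℝ) * h ^ 2 ≤ (72 * K) * h ^ 2 := by nlinarith
    have h6 : (J.card : ℝ) ≤ 72 * K := le_of_mul_le_mul_right h5 (by positivity)
    exact_mod_cast h6.trans (Nat.le_ceil _)
  set t : ℕ → ℝ := fun j => a + (j + 1) * h
  obtain ⟨e, he, hprod⟩ := exists_enumeration t b J _ hJcard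
  have hflip : ∀ k < M, ∀ x ∈ I k, ℓ 0 * flipSign ⌈72 * K⌉₊ e x = ℓ k := by
    intro k hk x hx
    have hxb : ¬ b ≤ x := (hIsub k hk hx).2.not_ge
    have htx : ∀ j, t j ≤ x ↔ j < k := by
      intro j
      constructor
      · intro hj
        have h1 : ((j : ℝ) + 1) * h < (k + 1) * h := by
          simp only [t] at hj
          linarith [hx.2]
        have h2 := lt_of_mul_lt_mul_right h1 hh0.le
        exact_mod_cast (add_lt_add_iff_right 1).1 h2
      · intro hj
        have h1 : (j : ℝ) + 1 ≤ k := by exact_mod_cast hj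
        have h2 : ((j : ℝ) + 1) * h ≤ k * h := by gcongr
        simp only [t]
        linarith [hx.1]
    have hfac : flipSign ⌈72 * K⌉₊ e x = ∏ j ∈ Finset.range k, ℓ j * ℓ (j + 1) := by
      rw [flipSign, hprod (fun y => if y ≤ x then -1 else 1) (if_neg hxb)]
      simp_rw [htx]
      rw [Finset.prod_filter, ← Finset.prod_subset (Finset.range_mono (by omega : k ≤ M - 1))]
      · refine Finset.prod_congr rfl fun j hj => ?_
        rw [if_pos (Finset.mem_range.1 hj)]
        rcases hℓ1 j with h1 | h1 <;> rcases hℓ1 (j + 1) with h2 | h2 <;> rw [h1, h2] <;> norm_num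
      · intro j _ hj
        rw [if_neg (fun h' => hj (Finset.mem_range.2 h')), ite_self]
    rw [hfac]
    clear hfac htx hxb hx hk
    induction k with
    | zero => simp
    | succ k ih =>
      rw [Finset.prod_range_succ, ← mul_assoc, ih, ← mul_assoc]
      rcases hℓ1 k with h1 | h1 <;> rw [h1] <;> ring
  refine ⟨ℓ 0, e, hℓ1 0, fun i => ?_, ?_⟩
  · rcases he i with h1 | ⟨j, hj, h1⟩
    · exact h1.symm ▸ right_mem_Icc.2 hab.le
    · rw [h1]
      have htj : t j ∈ I (j + 1) := by
        constructor <;> push_cast <;> simp only [t] <;> linarith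
      have := hIsub (j + 1) (hJM j hj) htj
      exact ⟨this.1, this.2.le⟩
  · set D : ℕ → Set ℝ := fun k => if ℓ k = 1 then Q k else P k
    have hD : ∀ k < M, μ.real (D k) ≤ 2 / h * (μ.real (P k) * μ.real (Q k)) := by
      intro k hk
      rw [div_mul_eq_mul_div, le_div_iff₀ hh0]
      have hP0 : 0 ≤ μ.real (P k) := measureReal_nonneg
      have hQ0 : 0 ≤ μ.real (Q k) := measureReal_nonneg
      by_cases hℓk : ℓ k = 1
      · simp only [D, if_pos hℓk]
        nlinarith [hℓP k hℓk]
      · simp only [D, if_neg hℓk]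
        nlinarith [hℓQ k hk ((hℓ1 k).resolve_left hℓk)]
    have hbad : {x | χ x ≠ ℓ 0 * flipSign ⌈72 * K⌉₊ e x} ∩ Ico a b ⊆
        ⋃ k ∈ Finset.range M, D k := by
      rintro x ⟨hx, hxab⟩
      obtain ⟨k, hk, hxk⟩ := hIcover x hxab
      rw [mem_ofPred_eq, hflip k hk x hxk] at hx
      refine mem_biUnion (Finset.mem_coe.2 (Finset.mem_range.2 hk)) ?_
      by_cases hℓk : ℓ k = 1
      · simp only [D, if_pos hℓk]
        exact ⟨hxk, (hχ1 x).resolve_left (hℓk ▸ hx)⟩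
      · simp only [D, if_neg hℓk]
        refine ⟨hxk, (hχ1 x).resolve_right ?_⟩
        rwa [(hℓ1 k).resolve_left hℓk] at hx
    calc μ.real {x | χ x ≠ ℓ 0 * flipSign ⌈72 * K⌉₊ e x}
        = μ.real ({x | χ x ≠ ℓ 0 * flipSign ⌈72 * K⌉₊ e x} ∩ Ico a b) := by
          simp only [hμ, measureReal_def, Measure.restrict_apply' measurableSet_Ico, inter_assoc,
            inter_self]
      _ ≤ μ.real (⋃ k ∈ Finset.range M, D k) := measureReal_mono hbad (measure_ne_top _ _)
      _ ≤ ∑ k ∈ Finset.range M, μ.real (D k) := measureReal_biUnion_finset_le _ _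
      _ ≤ ∑ k ∈ Finset.range M, 2 / h * (μ.real (P k) * μ.real (Q k)) :=
          Finset.sum_le_sum fun k hk => hD k (Finset.mem_range.1 hk)
      _ ≤ 2 / h * (K * δ ^ 2) := by
          rw [← Finset.mul_sum]
          gcongr
          refine hPQsum _ id fun k _ x hx y hy => ?_
          obtain ⟨hx1, hx2⟩ := hx
          obtain ⟨hy1, hy2⟩ := hy
          simp only [id] at hy1 hy2
          rw [abs_le]
          constructor <;> linarith
      _ ≤ (6 * K + 1) * δ := by
          rw [div_mul_eq_mul_div, div_le_iff₀ hh0]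
          have h1 : K * δ * δ ≤ K * δ * (3 * h) := by gcongr
          have h2 : 0 ≤ δ * h := by positivity
          nlinarith

/-- The energy bound in terms of the length scale `δ = ε ^ ((1 - a) / (-a))` of a transition. -/
lemma energy_bounds {a s D ε δ : ℝ} {V v : ℝ → ℝ} {E : Set ℝ} {C : ℝ≥0∞} (ha : a < 0)
    (hs : s = (1 - a) / 2) (hD : 0 < D) (hε : 0 < ε) (hδ : δ = ε ^ ((1 - a) / (-a)))
    (hG : Gfun a s D V ε E v ≤ C) :
    ∫⁻ x in E, ENNReal.ofReal (V (v x)) ≤ ENNReal.ofReal δ * C ∧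
    ∀ κ η : ℝ, 0 < κ → 0 < η →
      ENNReal.ofReal (δ ^ (1 + 2 * s) / κ ^ 2) * gag s E v +
        ENNReal.ofReal (2 * δ / η) * ∫⁻ x in E, ENNReal.ofReal (V (v x)) ≤
      ENNReal.ofReal ((D / κ ^ 2 + 2 / η) * δ ^ 2) * C := by
  have hδ0 : 0 < δ := hδ ▸ Real.rpow_pos_of_pos hε _
  have hεδ : ε ^ (-((1 - a) / (-a))) = 1 / δ := by rw [Real.rpow_neg hε.le, hδ, one_div]
  have hεq : ε ^ (1 - a) = δ ^ (-a) := by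
    rw [hδ, ← Real.rpow_mul hε.le, div_mul_cancel₀ _ (by linarith)]
  rw [Gfun, hεδ, hεq] at hG
  have hG1 := le_self_add.trans hG
  have hG2 := le_add_self.trans hG
  refine ⟨?_, fun κ η hκ hη => ?_⟩
  · calc ∫⁻ x in E, ENNReal.ofReal (V (v x))
        = ENNReal.ofReal δ * (ENNReal.ofReal (1 / δ) * ∫⁻ x in E, ENNReal.ofReal (V (v x))) := by
          rw [← mul_assoc, ← ENNReal.ofReal_mul hδ0.le, mul_one_div_cancel hδ0.ne',
            ENNReal.ofReal_one, one_mul]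
      _ ≤ _ := by gcongr
  · have h1 : δ ^ (1 + 2 * s) / κ ^ 2 = D / κ ^ 2 * δ ^ 2 * (δ ^ (-a) / D) := by
      have : δ ^ (1 + 2 * s) = δ ^ 2 * δ ^ (-a) := by
        rw [← Real.rpow_natCast, ← Real.rpow_add hδ0, hs]
        congr 1
        push_cast
        ring
      rw [this]
      field_simp
    have h2 : 2 * δ / η = 2 / η * δ ^ 2 * (1 / δ) := by field_simp
    rw [h1, h2, ENNReal.ofReal_mul (by positivity), ENNReal.ofReal_mul (p := 2 / η * δ ^ 2)
      (by positivity), add_mul (D / κ ^ 2), ENNReal.ofReal_add (by positivity) (by positivity),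
      add_mul, mul_assoc, mul_assoc]
    gcongr

/-- The sign of `z - m`, with value `1` at `m`. -/
noncomputable def sideSign (m z : ℝ) : ℝ := if m ≤ z then 1 else -1

lemma measurable_sideSign (m : ℝ) : Measurable (sideSign m) :=
  Measurable.ite measurableSet_Ici measurable_const measurable_const

lemma sideSign_eq_or (m z : ℝ) : sideSign m z = 1 ∨ sideSign m z = -1 := by
  unfold sideSign
  split_ifs <;> simp

lemma sideSign_eq_one_iff {m z : ℝ} : sideSign m z = 1 ↔ m ≤ z := by
  unfold sideSign
  split_ifs with h
  · simp [h]
  · simp only [h, iff_false]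
    norm_num

lemma sideSign_eq_neg_one_iff {m z : ℝ} : sideSign m z = -1 ↔ z < m := by
  unfold sideSign
  split_ifs with h
  · simp only [h.not_gt, iff_false]
    norm_num
  · simp [not_le.1 h]

lemma abs_sub_sideSign_le {α' β' : ℝ} (hαβ : α' < β') (z : ℝ) :
    |z - ((α' + β') / 2 + (β' - α') / 2 * sideSign ((α' + β') / 2) z)| ≤
      min |z - α'| |z - β'| := by
  unfold sideSign
  split_ifs with h
  · rw [show z - ((α' + β') / 2 + (β' - α') / 2 * 1) = z - β' by ring]
    refine le_min ?_ le_rfl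
    rw [abs_of_nonneg (by linarith : 0 ≤ z - α'), abs_le]
    constructor <;> linarith
  · rw [show z - ((α' + β') / 2 + (β' - α') / 2 * -1) = z - α' by ring]
    refine le_min le_rfl ?_
    push Not at h
    rw [abs_of_nonpos (by linarith : z - β' ≤ 0), abs_le]
    constructor <;> linarith

/-- Functions whose potential energy tends to zero approach the wells in `L¹`. -/
lemma tendsto_lintegral_dist_wells {V : ℝ → ℝ} {α' β' c R : ℝ} (hV0 : ∀ t, 0 ≤ V t)
    (hVc : Continuous V) (hVz : ∀ t, V t = 0 ↔ t = α' ∨ t = β') (hc : 0 < c) (hR : 0 < R)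
    (hcoerc : ∀ t : ℝ, R ≤ |t| → c * |t| ≤ V t) {μ : Measure ℝ} [IsFiniteMeasure μ]
    {v : ℕ → ℝ → ℝ}
    (h : Tendsto (fun n => ∫⁻ x, ENNReal.ofReal (V (v n x)) ∂μ) atTop (nhds 0)) :
    Tendsto (fun n => ∫⁻ x, ENNReal.ofReal (min |v n x - α'| |v n x - β'|) ∂μ) atTop (nhds 0) := by
  rw [ENNReal.tendsto_nhds_zero]
  intro e he
  obtain ⟨r, hr0, hre⟩ := ENNReal.lt_iff_exists_nnreal_btwn.1 he
  have hr0' : (0 : ℝ) < r := by exact_mod_cast hr0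
  have hμ : 0 ≤ μ.real univ := measureReal_nonneg
  set κ : ℝ := r / (2 * (μ.real univ + 1))
  have hκ : 0 < κ := by positivity
  obtain ⟨L, hL, hdist⟩ := dist_wells_le hV0 hVc hVz hc hR hcoerc hκ
  have h2 : Tendsto (fun n => ENNReal.ofReal L * ∫⁻ x, ENNReal.ofReal (V (v n x)) ∂μ) atTop
      (nhds 0) := by
    simpa using ENNReal.Tendsto.const_mul h (Or.inr ENNReal.ofReal_ne_top)
  filter_upwards [(ENNReal.tendsto_nhds_zero.1 h2) (ENNReal.ofReal (r / 2)) (by simpa using hr0)]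
    with n hn
  calc ∫⁻ x, ENNReal.ofReal (min |v n x - α'| |v n x - β'|) ∂μ
      ≤ ∫⁻ x, (ENNReal.ofReal κ + ENNReal.ofReal L * ENNReal.ofReal (V (v n x))) ∂μ := by
        refine lintegral_mono fun x => ?_
        rw [← ENNReal.ofReal_mul hL,
          ← ENNReal.ofReal_add hκ.le (mul_nonneg hL (hV0 _))]
        exact ENNReal.ofReal_le_ofReal (hdist _)
    _ = ENNReal.ofReal κ * μ univ + ENNReal.ofReal L * ∫⁻ x, ENNReal.ofReal (V (v n x)) ∂μ := by
        rw [lintegral_add_left measurable_const, lintegral_const,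
          lintegral_const_mul' _ _ ENNReal.ofReal_ne_top]
    _ ≤ ENNReal.ofReal (r / 2) + ENNReal.ofReal (r / 2) := by
        gcongr
        rw [← ofReal_measureReal, ← ENNReal.ofReal_mul hκ.le]
        refine ENNReal.ofReal_le_ofReal ?_
        simp only [κ]
        rw [div_mul_eq_mul_div, div_le_div_iff₀ (by positivity) two_pos]
        nlinarith
    _ = r := by
        rw [← ENNReal.ofReal_add (by positivity) (by positivity), add_halves,
          ENNReal.ofReal_coe_nnreal]
    _ ≤ e := hre.le

lemma tendsto_lintegral_flipSign {μ : Measure ℝ} [IsFiniteMeasure μ] [NullSingletonClass μ] {N : ℕ}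
    {σ : ℕ → ℝ} {σ' : ℝ} {e : ℕ → ℕ → ℝ} {e' : ℕ → ℝ} (hσ1 : ∀ n, σ n = 1 ∨ σ n = -1)
    (hσ : Tendsto σ atTop (nhds σ')) (he : Tendsto e atTop (nhds e')) {r : ℝ} (hr : 0 ≤ r)
    (hσ1' : σ' = 1 ∨ σ' = -1) :
    Tendsto (fun n => ∫⁻ x, ENNReal.ofReal
      (r * |σ n * flipSign N (e n) x - σ' * flipSign N e' x|) ∂μ) atTop (nhds 0) := by
  have hmeas : ∀ n, Measurable fun x => ENNReal.ofReal
      (r * |σ n * flipSign N (e n) x - σ' * flipSign N e' x|) := fun n =>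
    ((((measurable_flipSign N (e n)).const_mul _).sub
      ((measurable_flipSign N e').const_mul _)).abs.const_mul _).ennreal_ofReal
  have key := tendsto_lintegral_of_dominated_convergence (μ := μ) (f := fun _ => 0)
    (fun _ => ENNReal.ofReal (r * 2)) hmeas (fun n => ae_of_all _ fun x => ?_) ?_ ?_
  · simpa using key
  · refine ENNReal.ofReal_le_ofReal (mul_le_mul_of_nonneg_left ?_ hr)
    rcases hσ1 n with h1 | h1 <;> rcases hσ1' with h2 | h2 <;>
      rcases flipSign_eq_or N (e n) x with h3 | h3 <;>
      rcases flipSign_eq_or N e' x with h4 | h4 <;> rw [h1, h2, h3, h4] <;> norm_num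
  · simp [lintegral_const, ENNReal.mul_eq_top]
  · have hae : ∀ᵐ x ∂μ, x ∉ range e' := by
      have := (countable_range e').measure_zero μ
      exact measure_eq_zero_iff_ae_notMem.1 this
    filter_upwards [hae] with x hx
    have hlim := (((hσ.mul (tendsto_flipSign (N := N) he fun i _ hi => hx ⟨i, hi⟩)).sub_const
      (σ' * flipSign N e' x)).abs.const_mul r)
    simpa using ENNReal.tendsto_ofReal hlim

/- STATEMENT 9: compactness. If ε_n → 0⁺ and (v_n) has uniformly bounded energies
G_{ε_n}[v_n, E] on a bounded open interval E, then a subsequence converges in L¹(E) to a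
function taking values in {α', β'} a.e. with finitely many jumps. -/
theorem stmt_9 (a s D α' β' : ℝ) (V : ℝ → ℝ)
    (ha : a ∈ Set.Ioo (-1 : ℝ) 0) (hs : s = (1 - a) / 2) (hD : 0 < D) (hαβ : α' < β')
    (hV0 : ∀ t, 0 ≤ V t) (hVc : Continuous V)
    (hVz : ∀ t, V t = 0 ↔ t = α' ∨ t = β')
    (c R : ℝ) (hc : 0 < c) (hR : 0 < R) (hcoerc : ∀ t : ℝ, R ≤ |t| → c * |t| ≤ V t)
    (a₀ b₀ : ℝ) (hab : a₀ < b₀)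
    (ε : ℕ → ℝ) (hε : ∀ n, 0 < ε n) (hε0 : Tendsto ε atTop (nhds 0))
    (v : ℕ → ℝ → ℝ) (hv : ∀ n, Measurable (v n))
    (C : ℝ≥0∞) (hC : C ≠ ⊤)
    (hbdd : ∀ n, Gfun a s D V (ε n) (Ioo a₀ b₀) (v n) ≤ C) :
    ∃ σ : ℕ → ℕ, StrictMono σ ∧
      ∃ w : ℝ → ℝ,
        Tendsto (fun n => ∫⁻ x in Ioo a₀ b₀, ENNReal.ofReal |v (σ n) x - w x|)
          atTop (nhds 0) ∧
        (∀ᵐ x ∂volume.restrict (Ioo a₀ b₀), w x = α' ∨ w x = β') ∧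
        ∃ (N : ℕ) (t : ℕ → ℝ), t 0 = a₀ ∧ t (N + 1) = b₀ ∧
          (∀ i ≤ N, t i < t (i + 1)) ∧
          ∀ i ≤ N,
            (∀ᵐ x ∂volume.restrict (Ioo (t i) (t (i + 1))), w x = α') ∨
            (∀ᵐ x ∂volume.restrict (Ioo (t i) (t (i + 1))), w x = β') := by
  set m : ℝ := (α' + β') / 2 with hm
  set r : ℝ := (β' - α') / 2 with hr
  have hr0 : 0 < r := by simp only [hr]; linarith
  set μ : Measure ℝ := volume.restrict (Ioo a₀ b₀) with hμ
  have hexp : 0 < (1 - a) / (-a) := div_pos (by linarith [ha.2]) (by linarith [ha.2])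
  set δ : ℕ → ℝ := fun n => ε n ^ ((1 - a) / (-a))
  have hδ0 : ∀ n, 0 < δ n := fun n => Real.rpow_pos_of_pos (hε n) _
  have hδlim : Tendsto δ atTop (nhds 0) := by
    simpa [Real.zero_rpow hexp.ne'] using hε0.rpow_const (Or.inr hexp.le)
  have hen := fun n => energy_bounds ha.2 hs hD (hε n) rfl (hbdd n)
  have hVlim : Tendsto (fun n => ∫⁻ x, ENNReal.ofReal (V (v n x)) ∂μ) atTop (nhds 0) := by
    have h1 : Tendsto (fun n => ENNReal.ofReal (δ n) * C) atTop (nhds 0) := by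
      simpa using ENNReal.Tendsto.mul_const (ENNReal.tendsto_ofReal hδlim) (Or.inr hC)
    exact tendsto_of_tendsto_of_tendsto_of_le_of_le tendsto_const_nhds h1 (fun _ => zero_le)
      fun n => (hen n).1
  have hdlim := tendsto_lintegral_dist_wells hV0 hVc hVz hc hR hcoerc hVlim
  obtain ⟨η, hη, hηV⟩ : ∃ η > 0, ∀ z ∈ Icc m (m + r / 2), η ≤ V z := by
    obtain ⟨z, hz, hmin⟩ := isCompact_Icc.exists_isMinOn
      (nonempty_Icc.2 (by linarith : m ≤ m + r / 2)) hVc.continuousOn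
    refine ⟨V z, (hV0 z).lt_of_ne' fun h0 => ?_, fun z' hz' => hmin hz'⟩
    obtain ⟨h1, h2⟩ := hz
    rcases (hVz z).1 h0 with rfl | rfl <;> linarith
  set K : ℝ := (D / (r / 2) ^ 2 + 2 / η) * C.toReal
  obtain ⟨N, L, hL, hnear⟩ := exists_flipSign_near hab (by positivity : 0 ≤ K)
  have hpairs : ∀ n, (μ.prod μ).real {q | sideSign m (v n q.1) = 1 ∧ sideSign m (v n q.2) = -1 ∧
      |q.1 - q.2| ≤ δ n} ≤ K * δ n ^ 2 := by
    intro n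
    simp only [sideSign_eq_one_iff, sideSign_eq_neg_one_iff]
    have h1 := transition_pairs_le (hv n) hVc.measurable (half_pos hr0) hη (hδ0 n) (s := s)
      (by rw [hs]; linarith [ha.2]) (m := m) (fun z z' hz' hz => by
        by_cases hzr : z ≤ m + r / 2
        · exact Or.inr (hηV z ⟨hz, hzr⟩)
        · exact Or.inl (by linarith)) (Ioo a₀ b₀)
    have h2 := h1.trans ((hen n).2 _ _ (half_pos hr0) hη)
    have h3 := ENNReal.toReal_mono (ENNReal.mul_ne_top ENNReal.ofReal_ne_top hC) h2
    rw [ENNReal.toReal_mul, ENNReal.toReal_ofReal (by have := hδ0 n; positivity)] at h3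
    calc _ ≤ _ := h3
      _ = _ := by ring
  choose τ e hτ he hbad using fun n => hnear (fun x => sideSign m (v n x)) (δ n)
    ((measurable_sideSign m).comp (hv n)) (fun x => sideSign_eq_or _ _) (hδ0 n) (hpairs n)
  have hcomp : IsCompact (({1, -1} : Set ℝ) ×ˢ (Set.pi univ fun _ : ℕ => Icc a₀ b₀)) :=
    (Set.toFinite _).isCompact.prod (isCompact_univ_pi fun _ => isCompact_Icc)
  obtain ⟨⟨τ', e'⟩, hmem, σ, hσ, hlim⟩ := hcomp.tendsto_subseq
    (x := fun n => (τ n, e n)) fun n => ⟨hτ n, fun i _ => he n i⟩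
  have hτ' : τ' = 1 ∨ τ' = -1 := hmem.1
  have hτlim : Tendsto (fun n => τ (σ n)) atTop (nhds τ') := (Prod.tendsto_iff _ _).1 hlim |>.1
  have helim : Tendsto (fun n => e (σ n)) atTop (nhds e') := (Prod.tendsto_iff _ _).1 hlim |>.2
  have hσtop := hσ.tendsto_atTop
  set w : ℝ → ℝ := fun x => m + r * (τ' * flipSign N e' x)
  have hw : ∀ x, w x = α' ∨ w x = β' := by
    intro x
    rcases hτ' with h1 | h1 <;> rcases flipSign_eq_or N e' x with h2 | h2 <;>
      simp only [w, h1, h2, hm, hr]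
    exacts [Or.inr (by ring), Or.inl (by ring), Or.inl (by ring), Or.inr (by ring)]
  refine ⟨σ, hσ, w, ?_, ae_of_all _ hw, ?_⟩
  · have hlim2 : Tendsto (fun n => ENNReal.ofReal (r * 2) * ENNReal.ofReal (L * δ (σ n))) atTop
        (nhds 0) := by
      have h1 : Tendsto (fun n => L * δ (σ n)) atTop (nhds 0) := by
        simpa using (hδlim.comp hσtop).const_mul L
      simpa using ENNReal.Tendsto.const_mul (ENNReal.tendsto_ofReal h1)
        (Or.inr (ENNReal.ofReal_ne_top (r := r * 2)))
    have hlim3 := tendsto_lintegral_flipSign (μ := μ) (N := N) (fun n => hτ (σ n)) hτlim helim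
      hr0.le hτ'
    have hsum := ((hdlim.comp hσtop).add hlim2).add hlim3
    simp only [add_zero] at hsum
    refine tendsto_of_tendsto_of_tendsto_of_le_of_le tendsto_const_nhds hsum
      (fun _ => zero_le) fun n => ?_
    set W : ℝ → ℝ := fun x => τ (σ n) * flipSign N (e (σ n)) x
    set B : Set ℝ := {x | sideSign m (v (σ n) x) ≠ W x}
    have hWm : Measurable W := (measurable_flipSign _ _).const_mul _
    have hχm : Measurable fun x => sideSign m (v (σ n) x) := (measurable_sideSign m).comp (hv _)
    have hB : MeasurableSet B := (measurableSet_eq_fun hχm hWm).compl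
    have hBle : ∫⁻ x, B.indicator (fun _ => ENNReal.ofReal (r * 2)) x ∂μ ≤
        ENNReal.ofReal (r * 2) * ENNReal.ofReal (L * δ (σ n)) := by
      rw [lintegral_indicator_const hB, ← ofReal_measureReal]
      gcongr
      exact hbad (σ n)
    calc ∫⁻ x, ENNReal.ofReal |v (σ n) x - w x| ∂μ
        ≤ ∫⁻ x, (ENNReal.ofReal (min |v (σ n) x - α'| |v (σ n) x - β'|) +
            B.indicator (fun _ => ENNReal.ofReal (r * 2)) x +
            ENNReal.ofReal (r * |W x - τ' * flipSign N e' x|)) ∂μ := by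
          refine lintegral_mono fun x => ?_
          have h1 := abs_sub_sideSign_le hαβ (v (σ n) x)
          have h2 : ENNReal.ofReal (r * |sideSign m (v (σ n) x) - W x|) ≤
              B.indicator (fun _ => ENNReal.ofReal (r * 2)) x := by
            by_cases hx : x ∈ B
            · rw [indicator_of_mem hx]
              refine ENNReal.ofReal_le_ofReal (mul_le_mul_of_nonneg_left ?_ hr0.le)
              simp only [W]
              rcases hτ (σ n) with h3 | h3 <;> rcases flipSign_eq_or N (e (σ n)) x with h4 | h4 <;>
                rcases sideSign_eq_or m (v (σ n) x) with h5 | h5 <;> rw [h3, h4, h5] <;> norm_num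
            · rw [indicator_of_notMem hx, not_not.1 hx]
              simp
          refine le_trans ?_ (add_le_add_left (add_le_add_right h2 _) _)
          rw [← ENNReal.ofReal_add (by positivity) (by positivity),
            ← ENNReal.ofReal_add (by positivity) (by positivity)]
          refine ENNReal.ofReal_le_ofReal ?_
          have h3 : v (σ n) x - w x = (v (σ n) x - (m + r * sideSign m (v (σ n) x))) +
              r * (sideSign m (v (σ n) x) - W x) + r * (W x - τ' * flipSign N e' x) := by
            simp only [w]
            ring
          rw [h3]
          refine (abs_add_three _ _ _).trans ?_
          rw [abs_mul, abs_mul, abs_of_pos hr0]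
          gcongr
      _ = ∫⁻ x, ENNReal.ofReal (min |v (σ n) x - α'| |v (σ n) x - β'|) ∂μ +
            ∫⁻ x, B.indicator (fun _ => ENNReal.ofReal (r * 2)) x ∂μ +
            ∫⁻ x, ENNReal.ofReal (r * |W x - τ' * flipSign N e' x|) ∂μ := by
          rw [lintegral_add_right, lintegral_add_right _ (measurable_const.indicator hB)]
          exact ((hWm.sub
            ((measurable_flipSign N e').const_mul _)).abs.const_mul _).ennreal_ofReal
      _ ≤ _ := add_le_add_left (add_le_add_right hBle _) _
  · obtain ⟨M, t, h0, h1, hmono, hpart⟩ := exists_partition hab ((Finset.range N).image e')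
    refine ⟨M, t, h0, h1, hmono, fun i hi => ?_⟩
    obtain ⟨x, hx⟩ := nonempty_Ioo.2 (hmono i hi)
    have hconst : ∀ y ∈ Ioo (t i) (t (i + 1)), w y = w x := by
      intro y hy
      simp only [w]
      rw [flipSign_eq_of_mem_Ioo (fun j hj => hpart i hi _
        (Finset.mem_image_of_mem _ (Finset.mem_range.2 hj))) hy hx]
    rcases hw x with h | h
    · exact Or.inl ((ae_restrict_mem measurableSet_Ioo).mono fun y hy => (hconst y hy).trans h)
    · exact Or.inr ((ae_restrict_mem measurableSet_Ioo).mono fun y hy => (hconst y hy).trans h)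
end

section
/- For every T > 0 define κ_s^T := inf{ G₁[v, ℝ] : v measurable with G₁[v, ℝ] < ∞, v(x) = α' for all x ≤ −T, and v(x) = β' for all x ≥ T }. Then: (i) this infimum is attained by a non-decreasing function φ^T with α' ≤ φ^T(x) ≤ β' for all x; (ii) the map T ↦ κ_s^T is non-increasing; and (iii) κ_s^T → κ_s as T → +∞, where κ_s := inf{ G₁[v, ℝ] : v measurable with G₁[v, ℝ] < ∞, v(x) → α' as x → −∞, v(x) → β' as x → +∞ }. -/
open Real MeasureTheory Set Filter
open scoped ENNReal

/-- The functional G₁[v, ℝ] := (1/D) ∬ |v(x)−v(x')|²/|x−x'|^{1+2s} + ∫ V(v). -/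
noncomputable def Gone (D s : ℝ) (V : ℝ → ℝ) (v : ℝ → ℝ) : ℝ≥0∞ :=
  ENNReal.ofReal (1 / D) * gag s univ v + ∫⁻ x, ENNReal.ofReal (V (v x))

/-- The optimal-profile constant
κ_s := inf { G₁[v, ℝ] : v measurable, G₁[v, ℝ] < ∞, v → α' at −∞, v → β' at +∞ }. -/
noncomputable def kappa (D s α' β' : ℝ) (V : ℝ → ℝ) : ℝ≥0∞ :=
  sInf {t : ℝ≥0∞ | ∃ v : ℝ → ℝ, Measurable v ∧ Gone D s V v ≠ ⊤ ∧
    Tendsto v atBot (nhds α') ∧ Tendsto v atTop (nhds β') ∧ t = Gone D s V v}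

/-- The auxiliary optimal-profile constant
κ_s^T := inf { G₁[v, ℝ] : v measurable, G₁[v, ℝ] < ∞, v = α' on (−∞,−T], v = β' on [T,∞) }. -/
noncomputable def kappaT (D s α' β' : ℝ) (V : ℝ → ℝ) (T : ℝ) : ℝ≥0∞ :=
  sInf {t : ℝ≥0∞ | ∃ v : ℝ → ℝ, Measurable v ∧ Gone D s V v ≠ ⊤ ∧
    (∀ x : ℝ, x ≤ -T → v x = α') ∧ (∀ x : ℝ, T ≤ x → v x = β') ∧ t = Gone D s V v}

/-- The integrand of the Gagliardo double integral. -/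
noncomputable def gagDensity (s : ℝ) (v : ℝ → ℝ) (x y : ℝ) : ℝ≥0∞ :=
  ENNReal.ofReal ((v y - v x) ^ 2 / |y - x| ^ (1 + 2 * s))

lemma gag_univ (s : ℝ) (v : ℝ → ℝ) : gag s univ v = ∫⁻ x, ∫⁻ y, gagDensity s v x y := by
  simp [gag, gagDensity]

lemma measurable_gagDensity {s : ℝ} {v : ℝ → ℝ} (hv : Measurable v) :
    Measurable (fun p : ℝ × ℝ => gagDensity s v p.1 p.2) := by
  unfold gagDensity
  fun_prop

lemma measurable_gagDensity_right {s : ℝ} {v : ℝ → ℝ} (hv : Measurable v) (x : ℝ) :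
    Measurable (gagDensity s v x) := by
  unfold gagDensity
  fun_prop

lemma measurable_lintegral_gagDensity {s : ℝ} {v : ℝ → ℝ} (hv : Measurable v) :
    Measurable (fun x => ∫⁻ y, gagDensity s v x y) :=
  (measurable_gagDensity hv).lintegral_prod_right'

lemma gag_comp_add_right (s : ℝ) (v : ℝ → ℝ) (h : ℝ) :
    gag s univ (fun x => v (x + h)) = gag s univ v := by
  rw [gag_univ, gag_univ, ← lintegral_add_right_eq_self (fun x => ∫⁻ y, gagDensity s v x y) h]
  refine lintegral_congr fun x => ?_
  rw [← lintegral_add_right_eq_self (gagDensity s v (x + h)) h]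
  simp [gagDensity]

lemma gone_comp_add_right (D s : ℝ) (V v : ℝ → ℝ) (h : ℝ) :
    Gone D s V (fun x => v (x + h)) = Gone D s V v := by
  rw [Gone, Gone, gag_comp_add_right,
    lintegral_add_right_eq_self (fun x => ENNReal.ofReal (V (v x))) h]

lemma gone_comp_neg (D s : ℝ) (V v : ℝ → ℝ) :
    Gone D s V (fun x => v (-x)) = Gone D s V v := by
  have key (f : ℝ → ℝ≥0∞) : ∫⁻ x, f (-x) = ∫⁻ x, f x :=
    (Measure.measurePreserving_neg volume).lintegral_comp_emb
      (MeasurableEquiv.neg ℝ).measurableEmbedding f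
  rw [Gone, Gone, key fun x => ENNReal.ofReal (V (v x)), gag_univ, gag_univ]
  congr 2
  rw [← key]
  refine lintegral_congr fun x => ?_
  rw [← key]
  refine lintegral_congr fun y => ?_
  rw [gagDensity, gagDensity, neg_neg, neg_neg, ← abs_neg, neg_sub, neg_sub_neg]

lemma gagDensity_mono {s : ℝ} {v w : ℝ → ℝ} {x y : ℝ} (h : |w y - w x| ≤ |v y - v x|) :
    gagDensity s w x y ≤ gagDensity s v x y := by
  have := sq_le_sq.2 h
  unfold gagDensity
  gcongr

/-- If `Φ` is `1`-Lipschitz and does not increase the potential, composing with `Φ` does not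
increase the energy. -/
lemma gone_comp_le {D s : ℝ} {V Φ : ℝ → ℝ} (hΦ : LipschitzWith 1 Φ) (hV : ∀ t, V (Φ t) ≤ V t)
    (v : ℝ → ℝ) : Gone D s V (fun x => Φ (v x)) ≤ Gone D s V v := by
  rw [Gone, Gone, gag_univ, gag_univ]
  gcongr with x y x
  · exact gagDensity_mono (by simpa [Real.dist_eq] using hΦ.dist_le_mul (v y) (v x))
  · exact hV _

lemma sq_min_sub_min_add_sq_max_sub_max_le (a b c d : ℝ) :
    (min a c - min b d) ^ 2 + (max a c - max b d) ^ 2 ≤ (a - b) ^ 2 + (c - d) ^ 2 := by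
  rcases le_total a c with h | h <;> rcases le_total b d with h' | h' <;>
    simp only [min_eq_left, min_eq_right, max_eq_left, max_eq_right, h, h'] <;>
    nlinarith [mul_nonneg (sub_nonneg.2 h) (sub_nonneg.2 h')]

lemma gag_add_gag {s : ℝ} {v : ℝ → ℝ} (w : ℝ → ℝ) (hv : Measurable v) :
    gag s univ v + gag s univ w = ∫⁻ x, ∫⁻ y, (gagDensity s v x y + gagDensity s w x y) := by
  rw [gag_univ, gag_univ, ← lintegral_add_left (measurable_lintegral_gagDensity hv)]
  exact lintegral_congr fun x => (lintegral_add_left (measurable_gagDensity_right hv x) _).symm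

/-- Submodularity of the energy. -/
lemma gone_min_add_gone_max_le {D s : ℝ} {V v w : ℝ → ℝ} (hVc : Continuous V)
    (hv : Measurable v) (hw : Measurable w) :
    Gone D s V (fun x => min (v x) (w x)) + Gone D s V (fun x => max (v x) (w x)) ≤
      Gone D s V v + Gone D s V w := by
  have hgag : gag s univ (fun x => min (v x) (w x)) + gag s univ (fun x => max (v x) (w x)) ≤
      gag s univ v + gag s univ w := by
    rw [gag_add_gag _ hv, gag_add_gag _ (hv.min hw)]
    refine lintegral_mono fun x => lintegral_mono fun y => ?_
    simp only [gagDensity]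
    rw [← ENNReal.ofReal_add (by positivity) (by positivity),
      ← ENNReal.ofReal_add (by positivity) (by positivity), ← add_div, ← add_div]
    gcongr ENNReal.ofReal (?_ / _)
    exact sq_min_sub_min_add_sq_max_sub_max_le ..
  have hpot : (∫⁻ x, ENNReal.ofReal (V (min (v x) (w x)))) +
      ∫⁻ x, ENNReal.ofReal (V (max (v x) (w x))) =
      (∫⁻ x, ENNReal.ofReal (V (v x))) + ∫⁻ x, ENNReal.ofReal (V (w x)) := by
    have hm {u : ℝ → ℝ} (hu : Measurable u) : Measurable fun x => ENNReal.ofReal (V (u x)) :=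
      (hVc.measurable.comp hu).ennreal_ofReal
    rw [← lintegral_add_left (hm (hv.min hw)), ← lintegral_add_left (hm hv)]
    refine lintegral_congr fun x => ?_
    rcases le_total (v x) (w x) with h | h <;> simp [h, add_comm]
  calc _ = ENNReal.ofReal (1 / D) * (gag s univ (fun x => min (v x) (w x)) +
          gag s univ (fun x => max (v x) (w x))) + ((∫⁻ x, ENNReal.ofReal (V (min (v x) (w x)))) +
      ∫⁻ x, ENNReal.ofReal (V (max (v x) (w x)))) := by
        simp only [Gone]; ring
    _ ≤ ENNReal.ofReal (1 / D) * (gag s univ v + gag s univ w) +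
        ((∫⁻ x, ENNReal.ofReal (V (v x))) + ∫⁻ x, ENNReal.ofReal (V (w x))) := by
        rw [hpot]; gcongr
    _ = _ := by simp only [Gone]; ring

lemma ENNReal.liminf_add_liminf_le (u v : ℕ → ℝ≥0∞) :
    liminf u atTop + liminf v atTop ≤ liminf (fun n => u n + v n) atTop := by
  have mono (w : ℕ → ℝ≥0∞) : Monotone fun n => ⨅ i ≥ n, w i := fun m n h =>
    le_iInf₂ fun i hi => iInf₂_le i (h.trans hi)
  rw [liminf_eq_iSup_iInf_of_nat, liminf_eq_iSup_iInf_of_nat, liminf_eq_iSup_iInf_of_nat,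
    ENNReal.iSup_add_iSup_of_monotone (mono u) (mono v)]
  exact iSup_mono fun n => le_iInf₂ fun i hi => add_le_add (iInf₂_le i hi) (iInf₂_le i hi)

/-- Lower semicontinuity of the energy under almost everywhere convergence. -/
lemma gone_le_liminf {D s : ℝ} {V φ : ℝ → ℝ} {w : ℕ → ℝ → ℝ} (hVc : Continuous V)
    (hw : ∀ n, Measurable (w n))
    (h : ∀ᵐ x, Tendsto (fun n => w n x) atTop (nhds (φ x))) :
    Gone D s V φ ≤ liminf (fun n => Gone D s V (w n)) atTop := by
  have hgag : gag s univ φ ≤ liminf (fun n => gag s univ (w n)) atTop := by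
    simp only [gag_univ]
    refine le_trans (lintegral_mono_ae ?_)
      (lintegral_liminf_le fun n => measurable_lintegral_gagDensity (hw n))
    filter_upwards [h] with x hx
    refine le_trans (lintegral_mono_ae ?_)
      (lintegral_liminf_le fun n => measurable_gagDensity_right (hw n) x)
    filter_upwards [h] with y hy
    have : Tendsto (fun n => gagDensity s (w n) x y) atTop (nhds (gagDensity s φ x y)) :=
      ENNReal.tendsto_ofReal (((hy.sub hx).pow 2).div_const _)
    exact this.liminf_eq.ge
  have hpot : ∫⁻ x, ENNReal.ofReal (V (φ x)) ≤
      liminf (fun n => ∫⁻ x, ENNReal.ofReal (V (w n x))) atTop := by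
    refine le_trans (lintegral_mono_ae ?_)
      (lintegral_liminf_le fun n => (hVc.measurable.comp (hw n)).ennreal_ofReal)
    filter_upwards [h] with x hx
    exact (ENNReal.tendsto_ofReal ((hVc.tendsto _).comp hx)).liminf_eq.ge
  calc Gone D s V φ ≤ ENNReal.ofReal (1 / D) * liminf (fun n => gag s univ (w n)) atTop +
        liminf (fun n => ∫⁻ x, ENNReal.ofReal (V (w n x))) atTop := by
        rw [Gone]; gcongr
    _ = liminf (fun n => ENNReal.ofReal (1 / D) * gag s univ (w n)) atTop +
        liminf (fun n => ∫⁻ x, ENNReal.ofReal (V (w n x))) atTop := by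
        rw [ENNReal.liminf_const_mul_of_ne_top ENNReal.ofReal_ne_top]
    _ ≤ _ := ENNReal.liminf_add_liminf_le _ _

/-- The piecewise linear ramp from `0` to `1` across `[0, 1]`. -/
noncomputable def ramp (x : ℝ) : ℝ := max 0 (min 1 x)

lemma ramp_nonneg (x : ℝ) : 0 ≤ ramp x := le_max_left _ _

lemma ramp_le_one (x : ℝ) : ramp x ≤ 1 := max_le zero_le_one (min_le_left _ _)

lemma ramp_of_nonpos {x : ℝ} (h : x ≤ 0) : ramp x = 0 := max_eq_left ((min_le_right _ _).trans h)

lemma ramp_of_one_le {x : ℝ} (h : 1 ≤ x) : ramp x = 1 := by simp [ramp, h]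

lemma measurable_ramp : Measurable ramp := by unfold ramp; fun_prop

lemma abs_ramp_sub_ramp_le (x y : ℝ) : |ramp y - ramp x| ≤ |y - x| := by
  have : LipschitzWith 1 ramp := (LipschitzWith.id.const_min 1).const_max 0
  simpa [Real.dist_eq] using this.dist_le_mul y x

lemma abs_ramp_sub_ramp_le_one (x y : ℝ) : |ramp y - ramp x| ≤ 1 := by
  rw [abs_le]
  constructor <;> linarith [ramp_nonneg x, ramp_nonneg y, ramp_le_one x, ramp_le_one y]

lemma lintegral_sq_ramp_sub_le (z : ℝ) {r : ℝ} (hr : 0 ≤ r)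
    (h : ∀ x, (ramp (x + z) - ramp x) ^ 2 ≤ r) :
    ∫⁻ x, ENNReal.ofReal ((ramp (x + z) - ramp x) ^ 2) ≤ ENNReal.ofReal (r * (1 + 2 * |z|)) := by
  calc ∫⁻ x, ENNReal.ofReal ((ramp (x + z) - ramp x) ^ 2)
      ≤ ∫⁻ x, (Icc (-|z|) (1 + |z|)).indicator (fun _ => ENNReal.ofReal r) x := by
        refine lintegral_mono fun x => ?_
        by_cases hx : x ∈ Icc (-|z|) (1 + |z|)
        · simpa [hx] using ENNReal.ofReal_le_ofReal (h x)
        · have hz := abs_le.1 (le_refl |z|)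
          rw [mem_Icc, not_and_or, not_le, not_le] at hx
          have : ramp (x + z) - ramp x = 0 := by
            rcases hx with hx | hx
            · rw [ramp_of_nonpos, ramp_of_nonpos] <;> linarith [abs_nonneg z]
            · rw [ramp_of_one_le, ramp_of_one_le] <;> linarith [abs_nonneg z]
          simp [this]
    _ = ENNReal.ofReal (r * (1 + 2 * |z|)) := by
        rw [lintegral_indicator_const measurableSet_Icc, Real.volume_Icc,
          ← ENNReal.ofReal_mul hr]
        ring_nf

/-- The Gagliardo energy of the ramp is finite. -/
lemma gag_ramp_lt_top {s : ℝ} (hs : 1 / 2 < s) (hs' : s < 1) : gag s univ ramp < ⊤ := by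
  let F : ℝ → ℝ → ℝ≥0∞ := fun x z =>
    ENNReal.ofReal ((ramp (x + z) - ramp x) ^ 2) * ENNReal.ofReal (|z| ^ (1 + 2 * s))⁻¹
  have hF : Measurable (Function.uncurry F) := by
    have := measurable_ramp
    simp only [F, Function.uncurry_def]
    fun_prop
  have hgag : gag s univ ramp = ∫⁻ z, ∫⁻ x, F x z := by
    rw [gag_univ, ← lintegral_lintegral_swap hF.aemeasurable]
    refine lintegral_congr fun x => ?_
    rw [← lintegral_add_left_eq_self (gagDensity s ramp x) x]
    refine lintegral_congr fun z => ?_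
    simp only [gagDensity, F]
    rw [← ENNReal.ofReal_mul (by positivity), div_eq_mul_inv, add_sub_cancel_left]
  have hbound (z : ℝ) (r : ℝ) (hr : 0 ≤ r) (h : ∀ x, (ramp (x + z) - ramp x) ^ 2 ≤ r) :
      ∫⁻ x, F x z ≤ ENNReal.ofReal (r * (1 + 2 * |z|) / |z| ^ (1 + 2 * s)) := by
    rw [lintegral_mul_const' _ _ ENNReal.ofReal_ne_top, div_eq_mul_inv,
      ENNReal.ofReal_mul (by positivity)]
    gcongr
    exact lintegral_sq_ramp_sub_le z hr h
  let g : ℝ → ℝ≥0∞ := fun z => ∫⁻ x, F x z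
  have hsplit (f : ℝ → ℝ≥0∞) : ∫⁻ z, f z ≤
      (∫⁻ z in Ioc 0 1, f z) + (∫⁻ z in Ioi 1, f z) +
      ((∫⁻ z in Ioc 0 1, f (-z)) + ∫⁻ z in Ioi 1, f (-z)) := by
    have hpos (f : ℝ → ℝ≥0∞) :
        ∫⁻ z in Ioi 0, f z ≤ (∫⁻ z in Ioc 0 1, f z) + ∫⁻ z in Ioi 1, f z := by
      rw [← Ioc_union_Ioi_eq_Ioi zero_le_one]
      exact lintegral_union_le _ _ _
    have hneg : ∫⁻ z in Iic 0, f z = ∫⁻ z in Ioi 0, f (-z) := by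
      rw [← setLIntegral_congr Iio_ae_eq_Iic, ← (Measure.measurePreserving_neg
        (volume : Measure ℝ)).setLIntegral_comp_preimage_emb
        (MeasurableEquiv.neg ℝ).measurableEmbedding f (Iio 0)]
      simp
    rw [← lintegral_add_compl f measurableSet_Ioi, compl_Ioi, hneg]
    exact add_le_add (hpos f) (hpos _)
  have hsmall (z : ℝ) (hz : |z| ∈ Ioc (0 : ℝ) 1) :
      g z ≤ ENNReal.ofReal (3 * |z| ^ (1 - 2 * s)) := by
    refine (hbound z (|z| ^ 2) (by positivity) fun x => ?_).trans (ENNReal.ofReal_le_ofReal ?_)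
    · rw [sq_abs, sq_le_sq]
      simpa using abs_ramp_sub_ramp_le x (x + z)
    · have h : |z| ^ (1 - 2 * s) * |z| ^ (1 + 2 * s) = |z| ^ 2 := by
        rw [← Real.rpow_add hz.1, ← Real.rpow_natCast]; norm_num
      rw [div_le_iff₀ (Real.rpow_pos_of_pos hz.1 _), mul_assoc, h]
      nlinarith [hz.2, sq_nonneg |z|]
  have hlarge (z : ℝ) (hz : |z| ∈ Ioi (1 : ℝ)) :
      g z ≤ ENNReal.ofReal (3 * |z| ^ (-2 * s)) := by
    have hz1 : 1 < |z| := hz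
    have hz0 : 0 < |z| := zero_lt_one.trans hz
    refine (hbound z 1 zero_le_one fun x => ?_).trans (ENNReal.ofReal_le_ofReal ?_)
    · rw [sq_le_one_iff_abs_le_one]
      exact abs_ramp_sub_ramp_le_one x (x + z)
    · have h : |z| ^ (-2 * s) * |z| ^ (1 + 2 * s) = |z| := by
        rw [← Real.rpow_add hz0]; ring_nf; simp
      rw [div_le_iff₀ (Real.rpow_pos_of_pos hz0 _), mul_assoc, h]
      linarith
  have hfin {S : Set ℝ} (hS : MeasurableSet S) (h0 : ∀ z ∈ S, 0 < z) {p : ℝ}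
      (hp : IntegrableOn (fun z : ℝ => z ^ p) S) {f : ℝ → ℝ≥0∞}
      (hf : ∀ z ∈ S, f z ≤ ENNReal.ofReal (3 * z ^ p)) : ∫⁻ z in S, f z < ⊤ :=
    (setLIntegral_mono' hS hf).trans_lt (hp.const_mul 3).lintegral_lt_top
  have hI0 : IntegrableOn (fun z : ℝ => z ^ (1 - 2 * s)) (Ioc 0 1) := by
    rw [← intervalIntegrable_iff_integrableOn_Ioc_of_le zero_le_one]
    exact intervalIntegral.intervalIntegrable_rpow' (by linarith)
  have hI1 : IntegrableOn (fun z : ℝ => z ^ (-2 * s)) (Ioi 1) :=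
    integrableOn_Ioi_rpow_of_lt (by linarith) zero_lt_one
  have h0 : ∀ z ∈ Ioc (0 : ℝ) 1, 0 < z := fun z hz => hz.1
  have h1 : ∀ z ∈ Ioi (1 : ℝ), 0 < z := fun z hz => zero_lt_one.trans hz
  rw [hgag]
  refine (hsplit g).trans_lt (ENNReal.add_lt_top.2 ⟨ENNReal.add_lt_top.2 ⟨?_, ?_⟩,
    ENNReal.add_lt_top.2 ⟨?_, ?_⟩⟩)
  · exact hfin measurableSet_Ioc h0 hI0 fun z hz => by
      simpa [abs_of_pos (h0 z hz)] using hsmall z (by rwa [abs_of_pos (h0 z hz)])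
  · exact hfin measurableSet_Ioi h1 hI1 fun z hz => by
      simpa [abs_of_pos (h1 z hz)] using hlarge z (by rwa [abs_of_pos (h1 z hz)])
  · exact hfin measurableSet_Ioc h0 hI0 fun z hz => by
      simpa [abs_of_pos (h0 z hz)] using hsmall (-z) (by rwa [abs_neg, abs_of_pos (h0 z hz)])
  · exact hfin measurableSet_Ioi h1 hI1 fun z hz => by
      simpa [abs_of_pos (h1 z hz)] using hlarge (-z) (by rwa [abs_neg, abs_of_pos (h1 z hz)])

lemma sq_add_le_of_pos {ε : ℝ} (hε : 0 < ε) (a b : ℝ) :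
    (a + b) ^ 2 ≤ (1 + ε) * a ^ 2 + (1 + 1 / ε) * b ^ 2 := by
  have : 0 ≤ (ε * a - b) ^ 2 / ε := by positivity
  have h : (1 + ε) * a ^ 2 + (1 + 1 / ε) * b ^ 2 - (a + b) ^ 2 = (ε * a - b) ^ 2 / ε := by
    field_simp; ring
  linarith

/-- Cutting `v` off to its limit at `-∞` changes the squared increments by little. -/
lemma sq_cutoff_sub_cutoff_le {v θ : ℝ → ℝ} {α ε R : ℝ} (hε : 0 < ε)
    (hθ0 : ∀ x, 0 ≤ θ x) (hθ1 : ∀ x, θ x ≤ 1) (hθ : ∀ x, -R ≤ x → θ x = 1)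
    (hv : ∀ x ≤ -R, |v x - α| ≤ ε) (x y : ℝ) :
    ((α + (v y - α) * θ y) - (α + (v x - α) * θ x)) ^ 2 ≤
      (1 + ε) * (v y - v x) ^ 2 + (1 + 1 / ε) * (ε ^ 2 * (θ y - θ x) ^ 2) := by
  wlog hxy : x ≤ y generalizing x y
  · convert this y x (le_of_not_ge hxy) using 1 <;> ring
  have h1 : ((v y - v x) * θ y) ^ 2 ≤ (v y - v x) ^ 2 := by
    rw [mul_pow]
    exact mul_le_of_le_one_right (sq_nonneg _) (pow_le_one₀ (hθ0 y) (hθ1 y))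
  have h2 : ((v x - α) * (θ y - θ x)) ^ 2 ≤ ε ^ 2 * (θ y - θ x) ^ 2 := by
    rw [mul_pow]
    rcases le_total x (-R) with hx | hx
    · gcongr ?_ * _
      exact sq_le_sq.2 ((hv x hx).trans (le_abs_self ε))
    · simp [hθ x hx, hθ y (hx.trans hxy)]
  calc _ = ((v y - v x) * θ y + (v x - α) * (θ y - θ x)) ^ 2 := by ring
    _ ≤ (1 + ε) * ((v y - v x) * θ y) ^ 2 + (1 + 1 / ε) * ((v x - α) * (θ y - θ x)) ^ 2 :=
        sq_add_le_of_pos hε _ _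
    _ ≤ _ := by gcongr

lemma exists_cutoff_gone_le {D s α ε : ℝ} {V v : ℝ → ℝ} (hV0 : ∀ t, 0 ≤ V t)
    (hVc : Continuous V) (hVα : V α = 0) (hv : Measurable v) (hvα : Tendsto v atBot (nhds α))
    (hε : 0 < ε) :
    ∃ w : ℝ → ℝ, Measurable w ∧ (∀ᶠ x in atBot, w x = α) ∧ (∀ᶠ x in atTop, w x = v x) ∧
      Gone D s V w ≤ ENNReal.ofReal (1 + ε) * Gone D s V v +
        (ENNReal.ofReal ((ε ^ 2 + ε) / D) * gag s univ ramp + ENNReal.ofReal ε) := by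
  obtain ⟨δ, hδ, hVδ⟩ := Metric.continuous_iff.1 hVc α ε hε
  obtain ⟨R, hR⟩ : ∃ R : ℝ, ∀ x ≤ -R, |v x - α| < min ε δ := by
    obtain ⟨b, hb⟩ := eventually_atBot.1 (Metric.tendsto_nhds.1 hvα _ (lt_min hε hδ))
    exact ⟨-b, fun x hx => hb x (by simpa using hx)⟩
  set θ : ℝ → ℝ := fun x => ramp (x + (R + 1)) with hθdef
  have hθm : Measurable θ := measurable_ramp.comp (measurable_add_const _)
  have hθ : ∀ x, -R ≤ x → θ x = 1 := fun x hx => ramp_of_one_le (by linarith)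
  have hθ' : ∀ x ≤ -R - 1, θ x = 0 := fun x hx => ramp_of_nonpos (by linarith)
  have hθ0 : ∀ x, 0 ≤ θ x := fun x => ramp_nonneg _
  have hθ1 : ∀ x, θ x ≤ 1 := fun x => ramp_le_one _
  set w : ℝ → ℝ := fun x => α + (v x - α) * θ x with hw
  have hwm : Measurable w := by fun_prop
  refine ⟨w, hwm, ?_, ?_, ?_⟩
  · filter_upwards [eventually_le_atBot (-R - 1)] with x hx
    simp [hw, hθ' x hx]
  · filter_upwards [eventually_ge_atTop (-R)] with x hx
    simp [hw, hθ x hx]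
  have hgag : gag s univ w ≤ ENNReal.ofReal (1 + ε) * gag s univ v +
      ENNReal.ofReal (ε ^ 2 + ε) * gag s univ ramp := by
    rw [← gag_comp_add_right s ramp (R + 1), gag_univ s v, gag_univ, gag_univ,
      ← lintegral_const_mul _ (measurable_lintegral_gagDensity hv),
      ← lintegral_const_mul _ (measurable_lintegral_gagDensity hθm),
      ← lintegral_add_left ((measurable_lintegral_gagDensity hv).const_mul _)]
    refine lintegral_mono fun x => ?_
    rw [← lintegral_const_mul _ (measurable_gagDensity_right hv x),
      ← lintegral_const_mul _ (measurable_gagDensity_right hθm x),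
      ← lintegral_add_left ((measurable_gagDensity_right hv x).const_mul _)]
    refine lintegral_mono fun y => ?_
    simp only [gagDensity]
    rw [← ENNReal.ofReal_mul (by positivity), ← ENNReal.ofReal_mul (by positivity),
      ← ENNReal.ofReal_add (by positivity) (by positivity), mul_div_assoc', mul_div_assoc',
      ← add_div]
    gcongr ENNReal.ofReal (?_ / _)
    refine (sq_cutoff_sub_cutoff_le hε hθ0 hθ1 hθ
      (fun x hx => (hR x hx).le.trans (min_le_left _ _)) x y).trans_eq ?_
    field_simp
  have hpot : ∫⁻ x, ENNReal.ofReal (V (w x)) ≤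
      (∫⁻ x, ENNReal.ofReal (V (v x))) + ENNReal.ofReal ε := by
    have hVv : Measurable fun x => ENNReal.ofReal (V (v x)) :=
      (hVc.measurable.comp hv).ennreal_ofReal
    calc ∫⁻ x, ENNReal.ofReal (V (w x))
        ≤ ∫⁻ x, (ENNReal.ofReal (V (v x)) +
            (Ioc (-R - 1) (-R)).indicator (fun _ => ENNReal.ofReal ε) x) := by
          refine lintegral_mono fun x => ?_
          rcases le_or_gt x (-R - 1) with hx | hx
          · simp [hw, hθ' x hx, hVα]
          rcases le_or_gt x (-R) with hx' | hx'
          · have hwx : dist (w x) α < δ := by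
              rw [Real.dist_eq, hw, add_sub_cancel_left, abs_mul, abs_of_nonneg (hθ0 x)]
              exact (mul_le_of_le_one_right (abs_nonneg _) (hθ1 x)).trans_lt
                ((hR x hx').trans_le (min_le_right _ _))
            have h := hVδ _ hwx
            rw [hVα, Real.dist_eq, sub_zero, abs_of_nonneg (hV0 _)] at h
            rw [indicator_of_mem (show x ∈ Ioc (-R - 1) (-R) from ⟨hx, hx'⟩)]
            exact (ENNReal.ofReal_le_ofReal h.le).trans le_add_self
          · simp [hw, hθ x hx'.le]
      _ = _ := by
          rw [lintegral_add_left hVv, lintegral_indicator_const measurableSet_Ioc]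
          simp
  calc Gone D s V w ≤ ENNReal.ofReal (1 / D) * (ENNReal.ofReal (1 + ε) * gag s univ v +
        ENNReal.ofReal (ε ^ 2 + ε) * gag s univ ramp) +
        (ENNReal.ofReal (1 + ε) * (∫⁻ x, ENNReal.ofReal (V (v x))) + ENNReal.ofReal ε) := by
        unfold Gone
        gcongr
        refine hpot.trans ?_
        gcongr
        exact le_mul_of_one_le_left' (by simpa using hε.le)
    _ = _ := by
        rw [div_eq_mul_one_div (ε ^ 2 + ε), ENNReal.ofReal_mul (by positivity), Gone]
        ring

lemma exists_eventually_eq_atBot_gone_lt {D s α : ℝ} {V v : ℝ → ℝ} {c : ℝ≥0∞}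
    (hs : 1 / 2 < s) (hs' : s < 1) (hV0 : ∀ t, 0 ≤ V t)
    (hVc : Continuous V) (hVα : V α = 0) (hv : Measurable v) (hvα : Tendsto v atBot (nhds α))
    (hc : Gone D s V v < c) :
    ∃ w : ℝ → ℝ, Measurable w ∧ (∀ᶠ x in atBot, w x = α) ∧ (∀ᶠ x in atTop, w x = v x) ∧
      Gone D s V w < c := by
  have hlim : Tendsto (fun ε : ℝ => ENNReal.ofReal (1 + ε) * Gone D s V v +
        (ENNReal.ofReal ((ε ^ 2 + ε) / D) * gag s univ ramp + ENNReal.ofReal ε))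
      (nhdsWithin 0 (Ioi 0)) (nhds (Gone D s V v)) := by
    have h {f : ℝ → ℝ} (hf : Continuous f) : Tendsto (fun ε => ENNReal.ofReal (f ε))
        (nhdsWithin 0 (Ioi 0)) (nhds (ENNReal.ofReal (f 0))) :=
      ENNReal.tendsto_ofReal ((hf.tendsto 0).mono_left nhdsWithin_le_nhds)
    have h1 := ENNReal.Tendsto.mul_const (h (f := fun ε => 1 + ε) (by fun_prop))
      (.inr hc.ne_top)
    have h2 := ENNReal.Tendsto.mul_const (h (f := fun ε => (ε ^ 2 + ε) / D) (by fun_prop))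
      (.inr (gag_ramp_lt_top hs hs').ne)
    simpa using h1.add (h2.add (h continuous_id))
  obtain ⟨ε, hεc, hε⟩ := ((hlim.eventually_lt_const hc).and self_mem_nhdsWithin).exists
  obtain ⟨w, hw, hbot, htop, hle⟩ :=
    exists_cutoff_gone_le (s := s) hV0 hVc hVα hv hvα (mem_Ioi.1 hε)
  exact ⟨w, hw, hbot, htop, hle.trans_lt hεc⟩

lemma exists_eventually_eq_gone_lt {D s α β : ℝ} {V v : ℝ → ℝ} {c : ℝ≥0∞}
    (hs : 1 / 2 < s) (hs' : s < 1) (hV0 : ∀ t, 0 ≤ V t) (hVc : Continuous V)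
    (hVα : V α = 0) (hVβ : V β = 0) (hv : Measurable v) (hvα : Tendsto v atBot (nhds α))
    (hvβ : Tendsto v atTop (nhds β)) (hc : Gone D s V v < c) :
    ∃ w : ℝ → ℝ, Measurable w ∧ (∀ᶠ x in atBot, w x = α) ∧ (∀ᶠ x in atTop, w x = β) ∧
      Gone D s V w < c := by
  obtain ⟨w, hw, hwα, hwv, hwc⟩ :=
    exists_eventually_eq_atBot_gone_lt hs hs' hV0 hVc hVα hv hvα hc
  have hwβ : Tendsto (fun x => w (-x)) atBot (nhds β) :=
    (hvβ.congr' (hwv.mono fun x hx => hx.symm)).comp tendsto_neg_atBot_atTop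
  obtain ⟨u, hu, huβ, huw, huc⟩ :=
    exists_eventually_eq_atBot_gone_lt hs hs' hV0 hVc hVβ (hw.comp measurable_neg) hwβ
      (by rwa [← gone_comp_neg] at hwc)
  refine ⟨fun x => u (-x), hu.comp measurable_neg, ?_, tendsto_neg_atTop_atBot.eventually huβ,
    by rwa [gone_comp_neg]⟩
  filter_upwards [tendsto_neg_atBot_atTop.eventually huw, hwα] with x hx hx'
  simpa [hx'] using hx

lemma kappaT_le {D s α β T : ℝ} {V v : ℝ → ℝ} (hv : Measurable v) (hα : ∀ x ≤ -T, v x = α)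
    (hβ : ∀ x, T ≤ x → v x = β) : kappaT D s α β V T ≤ Gone D s V v := by
  by_cases h : Gone D s V v = ⊤
  · simp [h]
  · exact sInf_le ⟨v, hv, h, hα, hβ, rfl⟩

lemma kappaT_anti {D s α β T₁ T₂ : ℝ} {V : ℝ → ℝ} (h : T₁ ≤ T₂) :
    kappaT D s α β V T₂ ≤ kappaT D s α β V T₁ := by
  refine sInf_le_sInf ?_
  rintro _ ⟨v, hv, hfin, hα, hβ, rfl⟩
  exact ⟨v, hv, hfin, fun x hx => hα x (by linarith), fun x hx => hβ x (by linarith), rfl⟩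

lemma kappa_le_kappaT (D s α β T : ℝ) (V : ℝ → ℝ) :
    kappa D s α β V ≤ kappaT D s α β V T := by
  refine sInf_le_sInf ?_
  rintro _ ⟨v, hv, hfin, hα, hβ, rfl⟩
  exact ⟨v, hv, hfin,
    tendsto_const_nhds.congr' ((eventually_le_atBot (-T)).mono fun x hx => (hα x hx).symm),
    tendsto_const_nhds.congr' ((eventually_ge_atTop T).mono fun x hx => (hβ x hx).symm), rfl⟩

lemma tendsto_kappaT {D s α β : ℝ} {V : ℝ → ℝ} (hs : 1 / 2 < s) (hs' : s < 1)
    (hV0 : ∀ t, 0 ≤ V t) (hVc : Continuous V) (hVα : V α = 0) (hVβ : V β = 0) :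
    Tendsto (fun T => kappaT D s α β V T) atTop (nhds (kappa D s α β V)) := by
  refine tendsto_order.2 ⟨fun c hc => .of_forall fun T => hc.trans_le (kappa_le_kappaT ..),
    fun c hc => ?_⟩
  obtain ⟨_, ⟨v, hv, -, hvα, hvβ, rfl⟩, hvc⟩ := sInf_lt_iff.1 hc
  obtain ⟨w, hw, hwα, hwβ, hwc⟩ :=
    exists_eventually_eq_gone_lt hs hs' hV0 hVc hVα hVβ hv hvα hvβ hvc
  obtain ⟨A, hA⟩ := eventually_atBot.1 hwα
  obtain ⟨B, hB⟩ := eventually_atTop.1 hwβ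
  filter_upwards [eventually_ge_atTop (-A), eventually_ge_atTop B] with T hTA hTB
  exact (kappaT_le hw (fun x hx => hA x (by linarith)) fun x hx => hB x (hTB.trans hx)).trans_lt
    hwc

/-- **Helly's selection theorem**: a sequence of monotone functions with values in `[α, β]` has a
subsequence converging almost everywhere to a monotone function. -/
lemma exists_subseq_tendsto_ae_of_monotone {α β : ℝ} {u : ℕ → ℝ → ℝ} (hu : ∀ n, Monotone (u n))
    (hmem : ∀ n x, u n x ∈ Icc α β) :
    ∃ f : ℝ → ℝ, Monotone f ∧ (∀ x, f x ∈ Icc α β) ∧ ∃ ψ : ℕ → ℕ, StrictMono ψ ∧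
      ∀ᵐ x, Tendsto (fun n => u (ψ n) x) atTop (nhds (f x)) := by
  obtain ⟨l, hl, ψ, hψ, hlim⟩ := (isCompact_univ_pi fun _ : ℚ => isCompact_Icc).tendsto_subseq
    (x := fun n (q : ℚ) => u n q) fun n q _ => hmem n q
  have hlmem (q : ℚ) : l q ∈ Icc α β := hl q trivial
  have hlim (q : ℚ) : Tendsto (fun n => u (ψ n) q) atTop (nhds (l q)) :=
    (tendsto_pi_nhds.1 hlim) q
  have hne (x : ℝ) : (l '' {q : ℚ | (q : ℝ) < x}).Nonempty := Set.Nonempty.image l (exists_rat_lt x)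
  have hbdd (x : ℝ) : BddAbove (l '' {q : ℚ | (q : ℝ) < x}) :=
    ⟨β, by rintro _ ⟨q, -, rfl⟩; exact (hlmem q).2⟩
  set f : ℝ → ℝ := fun x => sSup (l '' {q : ℚ | (q : ℝ) < x}) with hf
  have hle {q : ℚ} {x : ℝ} (h : (q : ℝ) < x) : l q ≤ f x := le_csSup (hbdd x) ⟨q, h, rfl⟩
  have hfm : Monotone f := fun x y hxy =>
    csSup_le_csSup (hbdd y) (hne x) (image_mono fun q hq => lt_of_lt_of_le hq hxy)
  refine ⟨f, hfm, fun x => ⟨?_, ?_⟩, ψ, hψ, ?_⟩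
  · obtain ⟨q, hq⟩ := exists_rat_lt x
    exact (hlmem q).1.trans (hle hq)
  · exact csSup_le (hne x) (by rintro _ ⟨q, -, rfl⟩; exact (hlmem q).2)
  filter_upwards [hfm.countable_not_continuousAt.ae_notMem volume] with x hx
  have hx : ContinuousAt f x := not_not.1 hx
  refine tendsto_order.2 ⟨fun c hc => ?_, fun c hc => ?_⟩
  · obtain ⟨_, ⟨q, hq, rfl⟩, hcq⟩ := exists_lt_of_lt_csSup (hne x) hc
    filter_upwards [(hlim q).eventually_const_lt hcq] with n hn
    exact hn.trans_le (hu _ (le_of_lt hq))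
  · obtain ⟨y, hyc, hxy⟩ := (((hx.eventually_lt_const hc).filter_mono
      nhdsWithin_le_nhds).and (self_mem_nhdsWithin (s := Ioi x))).exists
    obtain ⟨q, hxq, hqy⟩ := exists_rat_btwn hxy
    filter_upwards [(hlim q).eventually_lt_const ((hle hqy).trans_lt hyc)] with n hn
    exact (hu _ hxq.le).trans_lt hn

/-- The forward average of `w` over intervals of length `δ`. -/
noncomputable def forwardAverage (δ : ℝ) (w : ℝ → ℝ) (x : ℝ) : ℝ :=
  δ⁻¹ * ∫ t in x..x + δ, w t

section forwardAverage

variable {δ α β : ℝ} {w : ℝ → ℝ}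

lemma intervalIntegrable_of_mem_Icc (hw : Measurable w) (hmem : ∀ x, w x ∈ Icc α β) (a b : ℝ) :
    IntervalIntegrable w volume a b := by
  refine (intervalIntegrable_const (c := max |α| |β|)).mono_fun hw.aestronglyMeasurable
    (.of_forall fun x => ?_)
  simpa using (abs_le_max_abs_abs (hmem x).1 (hmem x).2).trans (le_abs_self _)

lemma forwardAverage_mem_Icc (hδ : 0 < δ) (hw : Measurable w) (hmem : ∀ x, w x ∈ Icc α β)
    (x : ℝ) : forwardAverage δ w x ∈ Icc α β := by
  have hi := intervalIntegrable_of_mem_Icc hw hmem x (x + δ)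
  have h1 : ∫ _ in x..x + δ, α ≤ ∫ t in x..x + δ, w t :=
    intervalIntegral.integral_mono (by linarith) (by simp) hi fun t => (hmem t).1
  have h2 : ∫ t in x..x + δ, w t ≤ ∫ _ in x..x + δ, β :=
    intervalIntegral.integral_mono (by linarith) hi (by simp) fun t => (hmem t).2
  simp only [intervalIntegral.integral_const, add_sub_cancel_left, smul_eq_mul] at h1 h2
  rw [forwardAverage, inv_mul_eq_div, mem_Icc, le_div_iff₀' hδ, div_le_iff₀' hδ]
  exact ⟨h1, h2⟩

lemma monotone_forwardAverage (hδ : 0 < δ) (hw : Measurable w) (hmem : ∀ x, w x ∈ Icc α β)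
    (hmono : ∀ x, w x ≤ w (x + δ)) : Monotone (forwardAverage δ w) := by
  intro x y hxy
  have hi := intervalIntegrable_of_mem_Icc hw hmem
  have h1 : ∫ t in x..y, w t ≤ ∫ t in x..y, w (t + δ) :=
    intervalIntegral.integral_mono hxy (hi _ _)
      (intervalIntegrable_of_mem_Icc (hw.comp (measurable_add_const δ)) (fun t => hmem _) _ _)
      hmono
  rw [intervalIntegral.integral_comp_add_right] at h1
  have h2 := intervalIntegral.integral_add_adjacent_intervals (hi x y) (hi y (y + δ))
  have h3 := intervalIntegral.integral_add_adjacent_intervals (hi x (x + δ)) (hi (x + δ) (y + δ))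
  unfold forwardAverage
  gcongr
  linarith

/-- The distance of `w` to its forward average is controlled by the Gagliardo density. -/
lemma enorm_forwardAverage_sub_le {s ρ : ℝ} (hs : 1 / 2 ≤ s) (hρ : 0 < ρ) (hρ1 : ρ ≤ 1)
    (hw : Measurable w) (hmem : ∀ x, w x ∈ Icc α β) (x : ℝ) :
    ‖forwardAverage (ρ ^ 2) w x - w x‖ₑ ≤
      ENNReal.ofReal ρ * (1 + ∫⁻ y, gagDensity s w x y) := by
  set δ := ρ ^ 2 with hδ
  have hδ0 : 0 < δ := by positivity
  have hδ1 : δ ≤ 1 := pow_le_one₀ hρ.le hρ1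
  have hi := intervalIntegrable_of_mem_Icc hw hmem x (x + δ)
  have heq : forwardAverage δ w x - w x = δ⁻¹ * ∫ t in Ioc x (x + δ), (w t - w x) := by
    rw [← intervalIntegral.integral_of_le (by linarith), intervalIntegral.integral_sub hi (by simp),
      intervalIntegral.integral_const, forwardAverage, add_sub_cancel_left, smul_eq_mul]
    field_simp
  have hpt : ∀ t ∈ Ioc x (x + δ),
      ‖w t - w x‖ₑ ≤ ENNReal.ofReal ρ + ENNReal.ofReal (ρ * δ) * gagDensity s w x t := by
    rintro t ⟨hxt, htx⟩
    have hz : 0 < t - x := by linarith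
    rw [gagDensity, abs_of_pos hz, ← ENNReal.ofReal_mul (by positivity),
      ← ENNReal.ofReal_add (by positivity) (by positivity), ← ofReal_norm, Real.norm_eq_abs]
    refine ENNReal.ofReal_le_ofReal ?_
    have hpow : (t - x) ^ (1 + 2 * s) ≤ δ ^ 2 := by
      calc (t - x) ^ (1 + 2 * s) ≤ (t - x) ^ (2 : ℝ) :=
            Real.rpow_le_rpow_of_exponent_ge hz (by linarith) (by linarith)
        _ = (t - x) ^ 2 := Real.rpow_two _
        _ ≤ δ ^ 2 := by gcongr; linarith
    calc |w t - w x| ≤ ρ + |w t - w x| ^ 2 / ρ := by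
          rw [← sub_nonneg]
          have : ρ + |w t - w x| ^ 2 / ρ - |w t - w x| =
              ((|w t - w x| - ρ / 2) ^ 2 + 3 / 4 * ρ ^ 2) / ρ := by field_simp; ring
          rw [this]
          positivity
      _ = ρ + ρ * δ * ((w t - w x) ^ 2 / δ ^ 2) := by
          rw [sq_abs, hδ]; field_simp
      _ ≤ _ := by gcongr
  calc ‖forwardAverage δ w x - w x‖ₑ
      ≤ ENNReal.ofReal δ⁻¹ * ∫⁻ t in Ioc x (x + δ), ‖w t - w x‖ₑ := by
        rw [heq, enorm_mul, Real.enorm_of_nonneg (by positivity)]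
        gcongr
        exact enorm_integral_le_lintegral_enorm _
    _ ≤ ENNReal.ofReal δ⁻¹ * ∫⁻ t in Ioc x (x + δ),
          (ENNReal.ofReal ρ + ENNReal.ofReal (ρ * δ) * gagDensity s w x t) := by
        gcongr ENNReal.ofReal δ⁻¹ * ?_
        exact setLIntegral_mono' measurableSet_Ioc hpt
    _ ≤ ENNReal.ofReal δ⁻¹ * (ENNReal.ofReal (ρ * δ) +
          ENNReal.ofReal (ρ * δ) * ∫⁻ y, gagDensity s w x y) := by
        rw [lintegral_add_left measurable_const, setLIntegral_const, Real.volume_Ioc,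
          add_sub_cancel_left, ← ENNReal.ofReal_mul hρ.le,
          lintegral_const_mul _ (measurable_gagDensity_right hw x)]
        gcongr
        exact Measure.restrict_le_self
    _ = ENNReal.ofReal (δ⁻¹ * (ρ * δ)) * (1 + ∫⁻ y, gagDensity s w x y) := by
        rw [ENNReal.ofReal_mul (p := δ⁻¹) (by positivity)]
        ring
    _ = _ := by
        congr 2
        field_simp

end forwardAverage

/-- A sequence with bounded Gagliardo energy is almost everywhere asymptotic to its forward
averages at scale `4⁻ⁿ`. -/
lemma tendsto_forwardAverage_sub_ae {s α β : ℝ} {C : ℝ≥0∞} {w : ℕ → ℝ → ℝ} (hs : 1 / 2 ≤ s)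
    (hw : ∀ n, Measurable (w n)) (hmem : ∀ n x, w n x ∈ Icc α β) (hC : C ≠ ⊤)
    (hgag : ∀ n, gag s univ (w n) ≤ C) :
    ∀ᵐ x, Tendsto (fun n => forwardAverage (((1 / 2 : ℝ) ^ n) ^ 2) (w n) x - w n x)
      atTop (nhds 0) := by
  let ρ : ℕ → ℝ≥0∞ := fun n => ENNReal.ofReal ((1 / 2 : ℝ) ^ n)
  have hρ : ∑' n, ρ n ≠ ⊤ := summable_geometric_two.tsum_ofReal_ne_top
  have hm (n : ℕ) : Measurable fun x => ρ n * ∫⁻ y, gagDensity s (w n) x y :=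
    (measurable_lintegral_gagDensity (hw n)).const_mul _
  have hsum : ∫⁻ x, ∑' n, ρ n * ∫⁻ y, gagDensity s (w n) x y ≠ ⊤ := by
    rw [lintegral_tsum fun n => (hm n).aemeasurable]
    refine ne_top_of_le_ne_top (ENNReal.mul_ne_top hρ hC) ?_
    rw [← ENNReal.tsum_mul_right]
    refine ENNReal.tsum_le_tsum fun n => ?_
    rw [lintegral_const_mul _ (measurable_lintegral_gagDensity (hw n)), ← gag_univ]
    gcongr
    exact hgag n
  filter_upwards [ae_lt_top (.tsum hm) hsum] with x hx
  have h0 : Tendsto (fun n => ρ n + ρ n * ∫⁻ y, gagDensity s (w n) x y) atTop (nhds 0) := by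
    simpa using (ENNReal.tendsto_atTop_zero_of_tsum_ne_top hρ).add
      (ENNReal.tendsto_atTop_zero_of_tsum_ne_top hx.ne)
  rw [tendsto_zero_iff_enorm_tendsto_zero]
  refine tendsto_of_tendsto_of_tendsto_of_le_of_le tendsto_const_nhds h0 (fun n => zero_le)
    fun n => ?_
  refine (enorm_forwardAverage_sub_le hs (by positivity)
    (pow_le_one₀ (by norm_num) (by norm_num)) (hw n) (hmem n) x).trans_eq ?_
  rw [mul_add, mul_one]

/-- The pointwise minimum of the translates of `v` by `0, δ, …, kδ`. -/
noncomputable def minTranslates (δ : ℝ) (v : ℝ → ℝ) : ℕ → ℝ → ℝ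
  | 0 => v
  | k + 1 => fun x => min (v x) (minTranslates δ v k (x + δ))

lemma le_minTranslates_iff {δ : ℝ} {v : ℝ → ℝ} {k : ℕ} {x c : ℝ} :
    c ≤ minTranslates δ v k x ↔ ∀ j ≤ k, c ≤ v (x + j * δ) := by
  induction k generalizing x with
  | zero => simp [minTranslates]
  | succ k ih =>
    simp only [minTranslates, le_min_iff, ih]
    constructor
    · rintro ⟨h0, h⟩ (_ | i) hi
      · simpa using h0
      · have := h i (by lia)
        push_cast
        rwa [add_mul, one_mul, add_comm _ δ, ← add_assoc]
    · refine fun h => ⟨by simpa using h 0 (by lia), fun j hj => ?_⟩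
      have := h (j + 1) (by lia)
      push_cast at this
      rwa [add_mul, one_mul, add_comm _ δ, ← add_assoc] at this

lemma minTranslates_le {δ : ℝ} {v : ℝ → ℝ} {k j : ℕ} (hj : j ≤ k) (x : ℝ) :
    minTranslates δ v k x ≤ v (x + j * δ) :=
  le_minTranslates_iff.1 le_rfl j hj

lemma measurable_minTranslates {v : ℝ → ℝ} (hv : Measurable v) (δ : ℝ) (k : ℕ) :
    Measurable (minTranslates δ v k) := by
  induction k with
  | zero => exact hv
  | succ k ih => exact hv.min (ih.comp (measurable_add_const δ))

section minTranslates

variable {δ α β T : ℝ} {v : ℝ → ℝ}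

lemma minTranslates_mem_Icc (hmem : ∀ x, v x ∈ Icc α β) (k : ℕ) (x : ℝ) :
    minTranslates δ v k x ∈ Icc α β :=
  ⟨le_minTranslates_iff.2 fun _ _ => (hmem _).1,
    (minTranslates_le (zero_le (a := k)) x).trans (hmem _).2⟩

lemma minTranslates_eq_left (hmem : ∀ x, v x ∈ Icc α β) (hα : ∀ x ≤ -T, v x = α) (k : ℕ) {x : ℝ}
    (hx : x ≤ -T) : minTranslates δ v k x = α := by
  refine le_antisymm ?_ (minTranslates_mem_Icc hmem k x).1
  simpa [hα x hx] using minTranslates_le (δ := δ) (v := v) (zero_le (a := k)) x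

lemma minTranslates_eq_right (hδ : 0 ≤ δ) (hmem : ∀ x, v x ∈ Icc α β)
    (hβ : ∀ x, T ≤ x → v x = β) (k : ℕ) {x : ℝ} (hx : T ≤ x) : minTranslates δ v k x = β := by
  refine le_antisymm (minTranslates_mem_Icc hmem k x).2 (le_minTranslates_iff.2 fun j _ => ?_)
  exact (hβ _ (hx.trans (le_add_of_nonneg_right (by positivity)))).ge

lemma minTranslates_le_add (hδ : 0 ≤ δ) (hmem : ∀ x, v x ∈ Icc α β) (hα : ∀ x ≤ -T, v x = α)
    (hβ : ∀ x, T ≤ x → v x = β) {k : ℕ} (hk : 2 * T ≤ k * δ) (x : ℝ) :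
    minTranslates δ v k x ≤ minTranslates δ v k (x + δ) := by
  rcases le_total x (-T) with hx | hx
  · rw [minTranslates_eq_left hmem hα k hx]
    exact (minTranslates_mem_Icc hmem k _).1
  refine le_minTranslates_iff.2 fun j hj => ?_
  rcases hj.lt_or_eq with hj | rfl
  · convert minTranslates_le (δ := δ) (v := v) (Nat.succ_le_of_lt hj) x using 2
    push_cast
    ring
  · rw [hβ (x + δ + j * δ) (by linarith)]
    exact (minTranslates_mem_Icc hmem j x).2

/-- Taking the minimum of translates of an almost minimiser costs little energy. -/
lemma gone_minTranslates_le {D s : ℝ} {V : ℝ → ℝ} {ε : ℝ≥0∞} (hVc : Continuous V)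
    (hv : Measurable v) (hδ : 0 ≤ δ) (hmem : ∀ x, v x ∈ Icc α β) (hα : ∀ x ≤ -T, v x = α)
    (hβ : ∀ x, T ≤ x → v x = β) (hfin : kappaT D s α β V T ≠ ⊤)
    (hvε : Gone D s V v ≤ kappaT D s α β V T + ε) (k : ℕ) :
    Gone D s V (minTranslates δ v k) ≤ kappaT D s α β V T + (k + 1) * ε := by
  induction k with
  | zero => simpa [minTranslates] using hvε
  | succ k ih =>
    set κ := kappaT D s α β V T
    have hmax : κ ≤ Gone D s V fun x => max (v x) (minTranslates δ v k (x + δ)) := by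
      rw [← gone_comp_add_right D s V _ (-δ)]
      refine kappaT_le ?_ (fun x hx => ?_) fun x hx => ?_
      · exact (hv.comp (measurable_add_const _)).max
          ((measurable_minTranslates hv δ k).comp
            ((measurable_add_const _).comp (measurable_add_const _)))
      · simp [hα (x + -δ) (by linarith), minTranslates_eq_left hmem hα k hx]
      · simpa [minTranslates_eq_right hδ hmem hβ k hx] using (hmem _).2
    refine (ENNReal.add_le_add_iff_right hfin).1 ?_
    calc Gone D s V (minTranslates δ v (k + 1)) + κ
        ≤ Gone D s V (fun x => min (v x) (minTranslates δ v k (x + δ))) +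
            Gone D s V (fun x => max (v x) (minTranslates δ v k (x + δ))) := by
          gcongr
          exact le_rfl
      _ ≤ Gone D s V v + Gone D s V (fun x => minTranslates δ v k (x + δ)) :=
          gone_min_add_gone_max_le hVc hv
            ((measurable_minTranslates hv δ k).comp (measurable_add_const δ))
      _ = Gone D s V v + Gone D s V (minTranslates δ v k) := by rw [gone_comp_add_right]
      _ ≤ (κ + ε) + (κ + (k + 1) * ε) := add_le_add hvε ih
      _ = _ := by push_cast; ring

end minTranslates

/-- Almost minimisers of the constrained problem may be taken to be monotone at scale `δ`. -/
lemma exists_gone_le_kappaT_add {D s α β T δ η : ℝ} {V : ℝ → ℝ} (hαβ : α ≤ β)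
    (hV0 : ∀ t, 0 ≤ V t) (hVc : Continuous V) (hVα : V α = 0) (hVβ : V β = 0)
    (hδ : 0 < δ) (hη : 0 < η) (hfin : kappaT D s α β V T ≠ ⊤) :
    ∃ w : ℝ → ℝ, Measurable w ∧ (∀ x, w x ∈ Icc α β) ∧ (∀ x ≤ -T, w x = α) ∧
      (∀ x, T ≤ x → w x = β) ∧ (∀ x, w x ≤ w (x + δ)) ∧
      Gone D s V w ≤ kappaT D s α β V T + ENNReal.ofReal η := by
  obtain ⟨k, hk⟩ := exists_nat_ge (2 * T / δ)
  rw [div_le_iff₀ hδ] at hk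
  have hε : 0 < η / (k + 1) := by positivity
  obtain ⟨_, ⟨v₀, hv₀, -, hα₀, hβ₀, rfl⟩, hlt⟩ := sInf_lt_iff.1
    (ENNReal.lt_add_right hfin (ENNReal.ofReal_pos.2 hε).ne')
  let Φ : ℝ → ℝ := fun t => max α (min β t)
  have hΦ : LipschitzWith 1 Φ := (LipschitzWith.id.const_min β).const_max α
  have hΦV (t : ℝ) : V (Φ t) ≤ V t := by
    rcases le_total t α with h | h
    · simpa [Φ, h, h.trans hαβ, hVα] using hV0 t
    rcases le_total t β with h' | h'
    · simp [Φ, h, h']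
    · simpa [Φ, h', hαβ, hVβ] using hV0 t
  set v : ℝ → ℝ := fun x => Φ (v₀ x) with hvdef
  have hv : Measurable v := hΦ.continuous.measurable.comp hv₀
  have hmem (x : ℝ) : v x ∈ Icc α β := ⟨le_max_left _ _, max_le hαβ (min_le_left _ _)⟩
  have hα (x : ℝ) (hx : x ≤ -T) : v x = α := by simp [hvdef, Φ, hα₀ x hx]
  have hβ (x : ℝ) (hx : T ≤ x) : v x = β := by simp [hvdef, Φ, hβ₀ x hx, hαβ]
  refine ⟨minTranslates δ v k, measurable_minTranslates hv δ k, minTranslates_mem_Icc hmem k,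
    fun x hx => minTranslates_eq_left hmem hα k hx,
    fun x hx => minTranslates_eq_right hδ.le hmem hβ k hx,
    minTranslates_le_add hδ.le hmem hα hβ hk, ?_⟩
  refine (gone_minTranslates_le hVc hv hδ.le hmem hα hβ hfin
    ((gone_comp_le hΦ hΦV v₀).trans hlt.le) k).trans_eq ?_
  have : ((k : ℝ≥0∞) + 1) = ENNReal.ofReal (k + 1) := by
    rw [ENNReal.ofReal_add (by positivity) zero_le_one]; simp
  rw [this, ← ENNReal.ofReal_mul (by positivity), mul_div_cancel₀ _ (by positivity)]

/-- Redefining a monotone function as `α` to the left of `-T` and `β` to the right of `T`. -/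
lemma monotone_pin {α β T : ℝ} {f : ℝ → ℝ} (hαβ : α ≤ β) (hf : Monotone f)
    (hmem : ∀ x, f x ∈ Icc α β) :
    Monotone fun x => if x ≤ -T then α else if T ≤ x then β else f x := by
  intro x y hxy
  have hx := hmem x
  have hy := hmem y
  have := hf hxy
  simp only [mem_Icc] at hx hy ⊢
  split_ifs <;> linarith

lemma exists_monotone_gone_eq_kappaT {D s α β T : ℝ} {V : ℝ → ℝ} (hs : 1 / 2 ≤ s) (hD : 0 < D)
    (hT : 0 < T) (hαβ : α ≤ β) (hV0 : ∀ t, 0 ≤ V t) (hVc : Continuous V) (hVα : V α = 0)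
    (hVβ : V β = 0) :
    ∃ φ : ℝ → ℝ, Monotone φ ∧ (∀ x, φ x ∈ Icc α β) ∧ (∀ x ≤ -T, φ x = α) ∧
      (∀ x, T ≤ x → φ x = β) ∧ Gone D s V φ = kappaT D s α β V T := by
  set κ := kappaT D s α β V T with hκ
  suffices h : ∃ f : ℝ → ℝ, Monotone f ∧ (∀ x, f x ∈ Icc α β) ∧
      Gone D s V (fun x => if x ≤ -T then α else if T ≤ x then β else f x) ≤ κ by
    obtain ⟨f, hf, hmem, hle⟩ := h
    have hm := monotone_pin (T := T) hαβ hf hmem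
    have hα : ∀ x ≤ -T, (if x ≤ -T then α else if T ≤ x then β else f x) = α :=
      fun x hx => if_pos hx
    have hβ : ∀ x, T ≤ x → (if x ≤ -T then α else if T ≤ x then β else f x) = β :=
      fun x hx => by rw [if_neg (by linarith), if_pos hx]
    refine ⟨_, hm, fun x => ?_, hα, hβ, hle.antisymm (kappaT_le hm.measurable hα hβ)⟩
    split_ifs
    exacts [⟨le_rfl, hαβ⟩, ⟨hαβ, le_rfl⟩, hmem x]
  by_cases hfin : κ = ⊤
  · exact ⟨fun _ => α, monotone_const, fun _ => ⟨le_rfl, hαβ⟩, by simp [hfin]⟩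
  choose w hw hmem hα hβ hmono hle using fun n : ℕ =>
    exists_gone_le_kappaT_add (D := D) (s := s) (T := T) (δ := ((1 / 2 : ℝ) ^ n) ^ 2)
      (η := (1 / 2 : ℝ) ^ n) hαβ hV0 hVc hVα hVβ (by positivity) (by positivity) hfin
  have hgag (n : ℕ) : gag s univ (w n) ≤ ENNReal.ofReal D * (κ + 1) := by
    have h1 : ENNReal.ofReal (1 / D) * gag s univ (w n) ≤ κ + 1 := by
      refine le_self_add.trans ((hle n).trans ?_)
      gcongr
      exact ENNReal.ofReal_le_one.2 (pow_le_one₀ (by norm_num) (by norm_num))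
    calc gag s univ (w n)
        = ENNReal.ofReal D * (ENNReal.ofReal (1 / D) * gag s univ (w n)) := by
          rw [← mul_assoc, ← ENNReal.ofReal_mul hD.le, mul_one_div_cancel hD.ne']
          simp
      _ ≤ _ := by gcongr
  obtain ⟨f, hf, hfmem, ψ, hψ, hlim⟩ := exists_subseq_tendsto_ae_of_monotone
    (fun n => monotone_forwardAverage (by positivity) (hw n) (hmem n) (hmono n))
    fun n => forwardAverage_mem_Icc (by positivity) (hw n) (hmem n)
  refine ⟨f, hf, hfmem, ?_⟩
  have hae : ∀ᵐ x, Tendsto (fun n => w (ψ n) x) atTop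
      (nhds (if x ≤ -T then α else if T ≤ x then β else f x)) := by
    filter_upwards [hlim, tendsto_forwardAverage_sub_ae hs hw hmem
      (ENNReal.mul_ne_top ENNReal.ofReal_ne_top (ENNReal.add_ne_top.2 ⟨hfin, ENNReal.one_ne_top⟩))
      hgag] with x hx hx'
    split_ifs with h1 h2
    · simp [hα _ x h1]
    · simp [hβ _ x h2]
    · simpa using hx.sub (hx'.comp hψ.tendsto_atTop)
  refine (gone_le_liminf hVc (fun n => hw (ψ n)) hae).trans ?_
  have hη : Tendsto (fun n => κ + ENNReal.ofReal ((1 / 2 : ℝ) ^ ψ n)) atTop (nhds κ) := by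
    simpa using tendsto_const_nhds.add (ENNReal.tendsto_ofReal
      ((tendsto_pow_atTop_nhds_zero_of_lt_one (r := (1 / 2 : ℝ)) (by norm_num)
        (by norm_num)).comp hψ.tendsto_atTop))
  exact (liminf_le_liminf (.of_forall fun n => hle (ψ n))).trans_eq hη.liminf_eq

/- STATEMENT 12: (i) κ_s^T is attained by a non-decreasing function with values in
[α', β']; (ii) T ↦ κ_s^T is non-increasing; (iii) κ_s^T → κ_s as T → +∞. -/
theorem stmt_12 (a s D α' β' : ℝ) (V : ℝ → ℝ)
    (ha : a ∈ Set.Ioo (-1 : ℝ) 0) (hs : s = (1 - a) / 2) (hD : 0 < D) (hαβ : α' < β')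
    (hV0 : ∀ t, 0 ≤ V t) (hVc : Continuous V)
    (hVz : ∀ t, V t = 0 ↔ t = α' ∨ t = β') :
    (∀ T : ℝ, 0 < T →
      ∃ φ : ℝ → ℝ, Monotone φ ∧ (∀ x : ℝ, α' ≤ φ x ∧ φ x ≤ β') ∧
        (∀ x : ℝ, x ≤ -T → φ x = α') ∧ (∀ x : ℝ, T ≤ x → φ x = β') ∧
        Gone D s V φ = kappaT D s α' β' V T) ∧
    (∀ T₁ T₂ : ℝ, 0 < T₁ → T₁ ≤ T₂ →
      kappaT D s α' β' V T₂ ≤ kappaT D s α' β' V T₁) ∧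
    Tendsto (fun T => kappaT D s α' β' V T) atTop (nhds (kappa D s α' β' V)) := by
  obtain ⟨ha1, ha0⟩ := ha
  have hs1 : 1 / 2 < s := by linarith
  have hs2 : s < 1 := by linarith
  have hVα : V α' = 0 := (hVz α').2 (.inl rfl)
  have hVβ : V β' = 0 := (hVz β').2 (.inr rfl)
  exact ⟨fun T hT => exists_monotone_gone_eq_kappaT hs1.le hD hT hαβ.le hV0 hVc hVα hVβ,
    fun _ _ _ h => kappaT_anti h, tendsto_kappaT hs1 hs2 hV0 hVc hVα hVβ⟩
end
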